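/- arXiv:1711.03909 — 3 statements merged into one kernel-verified Lean document; each statement's English description precedes it below -/
import Mathlib

section
/- Let X be an algebraic variety over an algebraically closed field k of characteristic zero and let x ∈ X be a regular closed point. Then RZ(X,x) is self-homeomorphic: for every non-empty open subset U of RZ(X,x) there exists a subset V ⊆ U such that V, with the subspace topology, is homeomorphic to RZ(X,x). -/
open AlgebraicGeometry CategoryTheory

universe u

noncomputable section

/-- The homomorphism `𝒪_{X,x} → K` from the stalk at a point to the function field of an
integral scheme. -/
def stalkToFunctionField (X : Scheme.{u}) [IsIntegral X] (x : X) :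
    X.presheaf.stalk x →+* X.functionField :=
  algebraMap (X.presheaf.stalk x) X.functionField

/-- A point of the Riemann–Zariski space attached to a local ring `R` and a field `K`
(via `φ : R → K`): (the equivalence class of) a valuation of `K`, encoded by its
valuation ring, a valuation subring of `K` which *dominates* `R`, i.e. contains `φ(R)`
and whose maximal ideal pulls back to the maximal ideal of `R`.  (Such a valuation is
automatically trivial on any field contained in `R`.) -/
structure RZPoint {R K : Type u} [CommRing R] [IsLocalRing R] [Field K]
    (φ : R →+* K) where
  val : ValuationSubring K
  dom_le : ∀ a : R, φ a ∈ val
  dom_lt : ∀ a ∈ IsLocalRing.maximalIdeal R,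
    (⟨φ a, dom_le a⟩ : val) ∈ IsLocalRing.maximalIdeal val

/-- The Zariski topology on the Riemann–Zariski space: it is generated by the basic
open sets `E(f₁,…,f_m) = {ν | f₁,…,f_m ∈ R_ν}`, equivalently by the `E(f)`, `f ∈ K`. -/
instance {R K : Type u} [CommRing R] [IsLocalRing R] [Field K] (φ : R →+* K) :
    TopologicalSpace (RZPoint φ) :=
  TopologicalSpace.generateFrom {s | ∃ f : K, s = {v : RZPoint φ | f ∈ v.val}}

/-- The Riemann–Zariski space `RZ(X,x)` of an (integral) algebraic variety `X` at a
point `x`: the space of all valuations of the function field `K` of `X` extending the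
trivial valuation of the base field (this is automatic) whose valuation ring dominates
the local ring `𝒪_{X,x}`, with the Zariski topology. -/
def RZ (X : Scheme.{u}) [IsIntegral X] (x : X) : Type u :=
  RZPoint (stalkToFunctionField X x)

instance (X : Scheme.{u}) [IsIntegral X] (x : X) : TopologicalSpace (RZ X x) :=
  inferInstanceAs (TopologicalSpace (RZPoint (stalkToFunctionField X x)))

/-- A local ring is *regular* if its maximal ideal can be generated by a number of
elements equal to its Krull dimension. -/
def IsRegularLocal (R : Type*) [CommRing R] [IsLocalRing R] : Prop :=
  ∃ s : Finset R, Ideal.span (s : Set R) = IsLocalRing.maximalIdeal R ∧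
    (s.card : WithBot ℕ∞) = ringKrullDim R

section ValuationExtension

open Polynomial

variable {F L : Type*} [Field F] [Field L] [Algebra F L]

theorem ValuationSubring.isIntegral_of_forall_mem (V : ValuationSubring F) {b : L}
    (h : ∀ W : ValuationSubring L, V ≤ W.comap (algebraMap F L) → b ∈ W) : IsIntegral V b := by
  by_contra hb
  have : IsIntegrallyClosedIn (integralClosure V L).toSubring L :=
    inferInstanceAs (IsIntegrallyClosedIn (integralClosure V L) L)
  obtain ⟨W, hW, hbW⟩ := Subring.exists_le_valuationSubring_of_isIntegrallyClosedIn
    (R := (integralClosure V L).toSubring) (x := b) hb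
  exact hbW (h W fun a ha ↦ hW ((integralClosure V L).algebraMap_mem ⟨a, ha⟩))

theorem ValuationSubring.aeval_mem (W : ValuationSubring L) {p : F[X]} {t : L}
    (hp : ∀ i, p.coeff i ∈ W.comap (algebraMap F L)) (ht : t ∈ W) : aeval t p ∈ W := by
  rw [aeval_eq_sum_range]
  refine sum_mem fun i _ ↦ ?_
  rw [Algebra.smul_def]
  exact MulMemClass.mul_mem (hp i) (pow_mem ht i)

theorem ValuationSubring.valuation_aeval_sub_lt_one (W : ValuationSubring L) {p : F[X]} {t : L}
    (hp : ∀ i, p.coeff i ∈ W.comap (algebraMap F L)) (ht : W.valuation t < 1) :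
    W.valuation (aeval t p - algebraMap F L (p.coeff 0)) < 1 := by
  have h : aeval t p - algebraMap F L (p.coeff 0) = aeval t p.divX * t := by
    conv_lhs => rw [← divX_mul_X_add p]
    simp
  rw [h, map_mul, mul_comm]
  refine mul_lt_one_of_lt_of_le ht ((W.valuation_le_one_iff _).2 (W.aeval_mem (fun i ↦ ?_)
    ((W.valuation_le_one_iff _).1 ht.le)))
  rw [coeff_divX]
  exact hp _

theorem ValuationSubring.valuation_aeval_eq_one (W : ValuationSubring L) {p : F[X]} {t : L}
    (hp : ∀ i, p.coeff i ∈ W.comap (algebraMap F L)) (ht : W.valuation t < 1)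
    (h0 : W.valuation (algebraMap F L (p.coeff 0)) = 1) : W.valuation (aeval t p) = 1 := by
  rw [← h0]
  refine Valuation.map_eq_of_sub_lt _ ?_
  rw [h0]
  exact W.valuation_aeval_sub_lt_one hp ht

theorem Polynomial.exists_aeval_eq_zero_coeff_mem (V : ValuationSubring F)
    {f : L} (hf : IsAlgebraic F f) :
    ∃ (p : F[X]) (j : ℕ), aeval f p = 0 ∧ (∀ i, p.coeff i ∈ V) ∧ p.coeff j = 1 ∧
      ∀ i, j < i → V.valuation (p.coeff i) < 1 := by
  obtain ⟨p, hp0, hp⟩ := hf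
  obtain ⟨m, hm, hmax⟩ := p.support.exists_max_image (fun i ↦ V.valuation (p.coeff i))
    (by simpa using hp0)
  let S := p.support.filter fun i ↦ V.valuation (p.coeff i) = V.valuation (p.coeff m)
  have hS : S.Nonempty := ⟨m, by simpa [S] using hm⟩
  obtain ⟨hj0, hj⟩ : S.max' hS ∈ p.support ∧ _ := by simpa [S] using S.max'_mem hS
  have hjv := hj
  replace hj0 : p.coeff (S.max' hS) ≠ 0 := by simpa using hj0
  have hv0 : 0 < V.valuation (p.coeff (S.max' hS)) :=
    zero_lt_iff.2 ((Valuation.ne_zero_iff _).2 hj0)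
  have hle (i) : V.valuation (p.coeff i) ≤ V.valuation (p.coeff (S.max' hS)) := by
    by_cases hi : i ∈ p.support
    · rw [hjv]; exact hmax i hi
    · rw [notMem_support_iff.1 hi]; simp
  refine ⟨C (p.coeff (S.max' hS))⁻¹ * p, S.max' hS, by simp [hp], fun i ↦ ?_, ?_, fun i hi ↦ ?_⟩
  · rw [← V.valuation_le_one_iff, coeff_C_mul, map_mul, map_inv₀, inv_mul_le_one₀ hv0]
    exact hle i
  · simp [hj0]
  · rw [coeff_C_mul, map_mul, map_inv₀, inv_mul_lt_one₀ hv0]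
    refine lt_of_le_of_ne (hle i) fun h ↦ ?_
    refine absurd (S.le_max' i ?_) (not_le.2 hi)
    have h0 : p.coeff i ≠ 0 := by
      intro h'
      rw [h', map_zero] at h
      exact hv0.ne h
    simpa [S, h0] using h.trans hjv

theorem ValuationSubring.exists_isIntegral_mul_eq [Algebra.IsAlgebraic F L]
    (W : ValuationSubring L) {f : L} (hf : f ∈ W) :
    ∃ b c : L, IsIntegral (W.comap (algebraMap F L)) b ∧
      IsIntegral (W.comap (algebraMap F L)) c ∧ W.valuation b = 1 ∧ f * b = c := by
  rcases eq_or_ne f 0 with rfl | hf0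
  · exact ⟨1, 0, isIntegral_one, isIntegral_zero, by simp, by simp⟩
  obtain ⟨p, j, hp, hpV, hpj, hlt⟩ := Polynomial.exists_aeval_eq_zero_coeff_mem
    (W.comap (algebraMap F L)) (Algebra.IsAlgebraic.isAlgebraic (R := F) f)
  set a : ℕ → L := fun i ↦ algebraMap F L (p.coeff i) with ha
  have hpj' : a j = 1 := by simp [ha, hpj]
  have hjN : j ∈ Finset.range (p.natDegree + 1) := by
    rw [Finset.mem_range, Nat.lt_succ_iff]
    exact le_natDegree_of_ne_zero (by simp [hpj])
  let b : L := ∑ i ∈ Finset.Ico j (p.natDegree + 1), a i * f ^ (i - j)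
  let c : L := ∑ i ∈ Finset.range j, a i * f⁻¹ ^ (j - 1 - i)
  have hbc : f * b = - c := by
    have h0 : ∑ i ∈ Finset.range (p.natDegree + 1), a i * f ^ i = 0 := by
      rw [← hp, aeval_eq_sum_range]
      simp [Algebra.smul_def, ha]
    have hb : f ^ j * b = ∑ i ∈ Finset.Ico j (p.natDegree + 1), a i * f ^ i := by
      rw [Finset.mul_sum]
      refine Finset.sum_congr rfl fun i hi ↦ ?_
      rw [mul_left_comm, ← pow_add, Nat.add_sub_cancel' (Finset.mem_Ico.1 hi).1]
    have hc : f ^ j * c = f * ∑ i ∈ Finset.range j, a i * f ^ i := by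
      rw [Finset.mul_sum, Finset.mul_sum]
      refine Finset.sum_congr rfl fun i hi ↦ ?_
      have hi' := Finset.mem_range.1 hi
      have : f ^ j = f * f ^ i * f ^ (j - 1 - i) := by
        rw [← pow_succ', ← pow_add]
        congr 1
        omega
      rw [this, inv_pow]
      field_simp
    have hsum := Finset.sum_range_add_sum_Ico (fun i ↦ a i * f ^ i)
      (Finset.mem_range.1 hjN).le
    have hfj : f ^ j ≠ 0 := pow_ne_zero _ hf0
    apply mul_left_cancel₀ hfj
    rw [mul_left_comm, hb, mul_neg, hc, ← mul_neg]
    congr 1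
    rw [h0] at hsum
    exact eq_neg_of_add_eq_zero_right hsum
  have hmem (W' : ValuationSubring L)
      (hW' : W.comap (algebraMap F L) ≤ W'.comap (algebraMap F L)) : b ∈ W' ∧ f * b ∈ W' := by
    have haW (i) : a i ∈ W' := hW' (hpV i)
    rcases W'.mem_or_inv_mem f with h | h
    · have hb : b ∈ W' := sum_mem fun i _ ↦ MulMemClass.mul_mem (haW i) (pow_mem h _)
      exact ⟨hb, MulMemClass.mul_mem h hb⟩
    · have hc : c ∈ W' := sum_mem fun i _ ↦ MulMemClass.mul_mem (haW i) (pow_mem h _)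
      refine ⟨?_, hbc ▸ NegMemClass.neg_mem hc⟩
      have : b = f⁻¹ * -c := by rw [← hbc, inv_mul_cancel_left₀ hf0]
      rw [this]
      exact MulMemClass.mul_mem h (NegMemClass.neg_mem hc)
  refine ⟨b, f * b, isIntegral_of_forall_mem _ fun W' h ↦ (hmem W' h).1,
    isIntegral_of_forall_mem _ fun W' h ↦ (hmem W' h).2, ?_, rfl⟩
  have hb : b = 1 + ∑ i ∈ Finset.Ico (j + 1) (p.natDegree + 1), a i * f ^ (i - j) := by
    rw [← hpj']
    simp only [b]
    rw [Finset.sum_eq_sum_Ico_succ_bot (Finset.mem_range.1 hjN)]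
    simp
  rw [hb]
  refine Valuation.map_one_add_of_lt (v := W.valuation) ?_
  refine Valuation.map_sum_lt' _ zero_lt_one fun i hi ↦ ?_
  rw [map_mul]
  refine mul_lt_one_of_lt_of_le ?_ ((W.valuation_le_one_iff _).2 (pow_mem hf _))
  have hi' := hlt i (Nat.lt_of_succ_le (Finset.mem_Ico.1 hi).1)
  rw [← mem_nonunits_iff, mem_nonunits_iff_or, mem_comap, map_inv₀] at hi'
  rw [← mem_nonunits_iff, mem_nonunits_iff_or]
  exact hi'.imp (fun h ↦ by simp [ha, h]) id

theorem ValuationSubring.exists_aeval_mul_eq [Algebra.IsAlgebraic F L]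
    (W : ValuationSubring L) {t : L} (ht : W.valuation t < 1)
    (hgen : IntermediateField.adjoin F {t} = ⊤)
    (hintegral : ∀ i, (minpoly F t).coeff i ∈ W.comap (algebraMap F L))
    (hder : W.valuation (aeval t (derivative (minpoly F t))) = 1) {f : L} (hf : f ∈ W) :
    ∃ p q : F[X], (∀ i, p.coeff i ∈ W.comap (algebraMap F L)) ∧
      (∀ i, q.coeff i ∈ W.comap (algebraMap F L)) ∧ q.coeff 0 = 1 ∧
      f * aeval t q = aeval t p := by
  set V := W.comap (algebraMap F L) with hV
  have key {y : L} (hy : IsIntegral V y) : ∃ g : F[X],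
      aeval t (derivative (minpoly F t)) * y = aeval t g ∧ ∀ i, g.coeff i ∈ V := by
    have hsurj : Function.Surjective (aeval (R := F) t) := by
      have h := IntermediateField.adjoin_simple_toSubalgebra_of_isAlgebraic
        (Algebra.IsAlgebraic.isAlgebraic (R := F) t)
      rw [hgen, IntermediateField.top_toSubalgebra] at h
      intro x
      have hx : x ∈ Algebra.adjoin F {t} := h ▸ Algebra.mem_top
      rwa [Algebra.adjoin_singleton_eq_range_aeval] at hx
    obtain ⟨g, hg, hgi⟩ := exists_derivative_mul_eq_and_isIntegral_coeff (R := V)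
      (φ := (aeval (R := F) t).restrictScalars V) (f := minpoly F t) (y := y) hsurj
      (minpoly.monic (Algebra.IsIntegral.isIntegral t))
      (fun i ↦ isIntegral_algebraMap (x := (⟨_, hintegral i⟩ : V)))
      (minpoly.ker_aeval_eq_span_minpoly F t) hy
    refine ⟨g, hg, fun i ↦ ?_⟩
    obtain ⟨a, ha⟩ := IsIntegrallyClosed.isIntegral_iff.1 (hgi i)
    rw [← ha]
    exact a.2
  obtain ⟨b, c, hb, hc, hb1, hfbc⟩ := W.exists_isIntegral_mul_eq (F := F) hf
  obtain ⟨q, hq, hqV⟩ := key hb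
  obtain ⟨p, hp, hpV⟩ := key hc
  have hq1 : W.valuation (aeval t q) = 1 := by rw [← hq, map_mul, hder, hb1, one_mul]
  have hq0 : W.valuation (algebraMap F L (q.coeff 0)) = 1 := by
    rw [← hq1]
    refine Valuation.map_eq_of_sub_lt _ ?_
    rw [Valuation.map_sub_swap, hq1]
    exact W.valuation_aeval_sub_lt_one hqV ht
  have hq0' : q.coeff 0 ≠ 0 := by
    intro h
    simp [h] at hq0
  have hinv : (q.coeff 0)⁻¹ ∈ V := by
    rw [hV, mem_comap, ← W.valuation_le_one_iff, map_inv₀, map_inv₀, hq0, inv_one]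
  refine ⟨C (q.coeff 0)⁻¹ * p, C (q.coeff 0)⁻¹ * q, fun i ↦ ?_, fun i ↦ ?_, by simp [hq0'], ?_⟩
  · rw [coeff_C_mul]; exact MulMemClass.mul_mem hinv (hpV i)
  · rw [coeff_C_mul]; exact MulMemClass.mul_mem hinv (hqV i)
  · rw [map_mul, map_mul, ← hp, ← hq, ← hfbc]; ring

end ValuationExtension

namespace RZPoint

section Basic

variable {R K : Type u} [CommRing R] [IsLocalRing R] [Field K] {φ : R →+* K}

theorem ext_val {v w : RZPoint φ} (h : v.val = w.val) : v = w := by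
  cases v; cases w; cases h; rfl

theorem valuation_lt_one (v : RZPoint φ) {a : R} (ha : a ∈ IsLocalRing.maximalIdeal R) :
    v.val.valuation (φ a) < 1 :=
  (v.val.valuation_lt_one_iff _).1 (v.dom_lt a ha)

/-- A valuation ring satisfying the domination conditions in terms of its valuation. -/
def ofValuation (V : ValuationSubring K) (h : ∀ a, φ a ∈ V)
    (h' : ∀ a ∈ IsLocalRing.maximalIdeal R, V.valuation (φ a) < 1) : RZPoint φ :=
  ⟨V, h, fun a ha ↦ (V.valuation_lt_one_iff _).2 (h' a ha)⟩

theorem isOpen_setOf_mem (f : K) : IsOpen {v : RZPoint φ | f ∈ v.val} :=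
  TopologicalSpace.isOpen_generateFrom_of_mem ⟨f, rfl⟩

theorem continuous_of_isOpen {Y : Type*} [TopologicalSpace Y] {g : Y → RZPoint φ}
    (h : ∀ f : K, IsOpen {y | f ∈ (g y).val}) : Continuous g :=
  continuous_generateFrom_iff.2 (by rintro _ ⟨f, rfl⟩; exact h f)

theorem exists_finset_subset {U : Set (RZPoint φ)} (hU : IsOpen U) {v : RZPoint φ} (hv : v ∈ U) :
    ∃ T : Finset K, (∀ f ∈ T, f ∈ v.val) ∧ {w : RZPoint φ | ∀ f ∈ T, f ∈ w.val} ⊆ U := by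
  classical
  induction hU with
  | basic s hs =>
    obtain ⟨f, rfl⟩ := hs
    exact ⟨{f}, by simpa using hv, fun w hw ↦ by simpa using hw⟩
  | univ => exact ⟨∅, by simp, fun _ _ ↦ trivial⟩
  | inter s t _ _ hs ht =>
    obtain ⟨S, hS, hS'⟩ := hs hv.1
    obtain ⟨T, hT, hT'⟩ := ht hv.2
    refine ⟨S ∪ T, fun f hf ↦ (Finset.mem_union.1 hf).elim (hS f) (hT f), fun w hw ↦
      ⟨hS' fun f hf ↦ hw f (Finset.mem_union_left _ hf),
        hT' fun f hf ↦ hw f (Finset.mem_union_right _ hf)⟩⟩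
  | sUnion S _ hS =>
    obtain ⟨s, hs, hvs⟩ := hv
    obtain ⟨T, hT, hT'⟩ := hS s hs hvs
    exact ⟨T, hT, hT'.trans (Set.subset_sUnion_of_mem hs)⟩

end Basic

section Core

open Polynomial IsLocalRing

variable {R₀ R F L : Type u} [CommRing R₀] [IsLocalRing R₀] [CommRing R] [IsLocalRing R]
  [Field F] [Field L] [Algebra R₀ R] [Algebra R₀ F] [Algebra R L] [Algebra R₀ L] [Algebra F L]
  [IsScalarTower R₀ R L] [IsScalarTower R₀ F L] [IsLocalHom (algebraMap R₀ R)]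

/-- Restriction of dominating valuations along a local homomorphism. -/
def comap (w : RZPoint (algebraMap R L)) : RZPoint (algebraMap R₀ F) :=
  ofValuation (w.val.comap (algebraMap F L))
    (fun a ↦ by
      rw [ValuationSubring.mem_comap, ← IsScalarTower.algebraMap_apply,
        IsScalarTower.algebraMap_apply R₀ R L]
      exact w.dom_le _)
    (fun a ha ↦ by
      rw [← ValuationSubring.mem_nonunits_iff, ValuationSubring.mem_nonunits_iff_or,
        ValuationSubring.mem_comap, map_inv₀,
        ← (map_eq_zero_iff _ (algebraMap F L).injective),
        ← ValuationSubring.mem_nonunits_iff_or, ValuationSubring.mem_nonunits_iff,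
        ← IsScalarTower.algebraMap_apply, IsScalarTower.algebraMap_apply R₀ R L]
      exact w.valuation_lt_one (map_nonunit (algebraMap R₀ R) a ha))

theorem continuous_comap :
    Continuous (comap : RZPoint (algebraMap R L) → RZPoint (algebraMap R₀ F)) :=
  continuous_of_isOpen fun f ↦ isOpen_setOf_mem (algebraMap F L f)

variable {t : R} {h : R₀[X]}

omit [IsLocalRing R] [IsLocalHom (algebraMap R₀ R)] [IsLocalRing R₀] [Algebra R₀ L]
  [IsScalarTower R₀ R L] [IsScalarTower R₀ F L] in
theorem _root_.ValuationSubring.exists_of_dominating [IsLocalRing R₀]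
    (v : RZPoint (algebraMap R₀ F)) {t : L} (hm : h.Monic)
    (hmin : minpoly F t = h.map (algebraMap R₀ F)) (h0 : h.coeff 0 ∈ maximalIdeal R₀) :
    ∃ W : ValuationSubring L, W.comap (algebraMap F L) = v.val ∧ W.valuation t < 1 ∧
      ∀ a : F, v.val.valuation a < 1 → W.valuation (algebraMap F L a) < 1 := by
  let ι : R₀ →+* v.val := (algebraMap R₀ F).codRestrict v.val v.dom_le
  let ψ : v.val[X] →+* L := eval₂RingHom ((algebraMap F L).comp v.val.subtype) t
  have hψ (p : v.val[X]) : ψ p = aeval t (p.map v.val.subtype) := by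
    simp [ψ, aeval_def, eval₂_map]
  let J : Ideal v.val[X] := (maximalIdeal v.val).comap constantCoeff
  have hJ : J.map ψ.rangeRestrict ≠ ⊤ := by
    rw [Ne, Ideal.eq_top_iff_one, Ideal.mem_map_iff_of_surjective _ ψ.rangeRestrict_surjective]
    rintro ⟨p, hp, hp1⟩
    have hp1' : ψ p = 1 := congr_arg Subtype.val hp1
    have hdvd : (h.map ι) ∣ 1 - p := by
      rw [← Polynomial.map_dvd_map v.val.subtype Subtype.val_injective (hm.map ι), map_map]
      change h.map (algebraMap R₀ F) ∣ _
      rw [← hmin, minpoly.dvd_iff, ← hψ, map_sub, map_one, hp1', sub_self]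
    obtain ⟨q, hq⟩ := hdvd
    have hc := congr_arg constantCoeff hq
    rw [map_sub, map_one, map_mul] at hc
    have h0' : constantCoeff (h.map ι) ∈ maximalIdeal v.val := by
      rw [constantCoeff_apply, coeff_map]
      exact v.dom_lt _ h0
    have := add_mem (Ideal.mul_mem_right (constantCoeff q) _ h0') (show constantCoeff p ∈ _ from hp)
    rw [← hc, sub_add_cancel] at this
    exact (Ideal.ne_top_iff_one _).1 (maximalIdeal.isMaximal _).ne_top this
  obtain ⟨W, hW, hJW⟩ := Ideal.image_subset_nonunits_valuationSubring _ hJ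
  have hle {a : F} (ha : a ∈ v.val) : algebraMap F L a ∈ W :=
    hW ⟨C ⟨a, ha⟩, by simp [ψ]⟩
  have hlt {p : v.val[X]} (hp : p ∈ J) : W.valuation (ψ p) < 1 := by
    rw [← ValuationSubring.mem_nonunits_iff]
    exact hJW ⟨_, Ideal.mem_map_of_mem ψ.rangeRestrict hp, rfl⟩
  have hlt' {a : F} (ha : v.val.valuation a < 1) : W.valuation (algebraMap F L a) < 1 := by
    have ha' : a ∈ v.val := (v.val.valuation_le_one_iff _).1 ha.le
    have := hlt (p := C ⟨a, ha'⟩) (by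
      rw [Ideal.mem_comap, constantCoeff_apply, coeff_C_zero, v.val.valuation_lt_one_iff]
      exact ha)
    simpa [ψ] using this
  refine ⟨W, le_antisymm (fun a ha ↦ ?_) fun a ha ↦ hle ha, ?_, fun a ↦ hlt'⟩
  · by_contra hav
    have hv1 : v.val.valuation a⁻¹ < 1 := by
      rw [map_inv₀]
      refine inv_lt_one_of_one_lt₀ ?_
      rwa [← not_le, v.val.valuation_le_one_iff]
    have := hlt' hv1
    rw [map_inv₀, map_inv₀] at this
    have ha1 : W.valuation (algebraMap F L a) ≤ 1 := (W.valuation_le_one_iff _).2 ha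
    rcases eq_or_ne a 0 with rfl | ha0
    · exact hav (zero_mem _)
    · have h0 : W.valuation (algebraMap F L a) ≠ 0 := by simpa using ha0
      exact this.not_ge ((one_le_inv₀ (zero_lt_iff.2 h0)).2 ha1)
  · have := hlt (p := X) (by
      simp [J])
    simpa [ψ] using this

theorem coeff_zero_mem_maximalIdeal (ht : t ∈ maximalIdeal R) {p : R₀[X]} :
    p.coeff 0 ∈ maximalIdeal R₀ ↔ aeval t p ∈ maximalIdeal R := by
  have h1 : aeval t p = aeval t p.divX * t + algebraMap R₀ R (p.coeff 0) := by
    conv_lhs => rw [← divX_mul_X_add p]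
    simp
  rw [h1, Ideal.add_mem_iff_right _ (Ideal.mul_mem_left _ _ ht)]
  simp

variable [Algebra.IsAlgebraic F L]

theorem nonempty_homeomorph (ht : t ∈ maximalIdeal R) (hm : h.Monic)
    (hmin : minpoly F (algebraMap R L t) = h.map (algebraMap R₀ F)) (h0 : aeval t h = 0)
    (hder : IsUnit (aeval t (derivative h)))
    (hgen : IntermediateField.adjoin F {algebraMap R L t} = ⊤)
    (hfrac : ∀ r : R, ∃ p q : R₀[X], IsUnit (aeval t q) ∧ r * aeval t q = aeval t p) :
    Nonempty (RZPoint (algebraMap R L) ≃ₜ RZPoint (algebraMap R₀ F)) := by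
  set tL := algebraMap R L t with htL
  have haev (p : R₀[X]) : algebraMap R L (aeval t p) = aeval tL (p.map (algebraMap R₀ F)) := by
    rw [aeval_map_algebraMap, htL, aeval_algebraMap_apply]
  have hunit {v : ValuationSubring L} (hv : ∀ r, algebraMap R L r ∈ v) {r : R} (hr : IsUnit r) :
      v.valuation (algebraMap R L r) = 1 := by
    obtain ⟨u, rfl⟩ := hr
    refine le_antisymm ((v.valuation_le_one_iff _).2 (hv _)) ?_
    have h1 : v.valuation (algebraMap R L u) * v.valuation (algebraMap R L ↑u⁻¹) = 1 := by
      rw [← map_mul, ← map_mul]; simp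
    rw [← h1]
    exact mul_le_of_le_one_right' ((v.valuation_le_one_iff _).2 (hv _))
  have hA (w : RZPoint (algebraMap R L)) {f : L} (hf : f ∈ w.val) := by
    refine w.val.exists_aeval_mul_eq (F := F) (t := tL) (w.valuation_lt_one ht) hgen
      (fun i ↦ ?_) ?_ hf
    · rw [hmin, coeff_map]
      exact (comap w).dom_le _
    · rw [hmin, derivative_map, ← haev]
      exact hunit w.dom_le hder
  have hA' (w : RZPoint (algebraMap R L)) {f : L} {p q : F[X]}
      (hp : ∀ i, p.coeff i ∈ w.val.comap (algebraMap F L))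
      (hq : ∀ i, q.coeff i ∈ w.val.comap (algebraMap F L)) (hq0 : q.coeff 0 = 1)
      (hf : f * aeval tL q = aeval tL p) : f ∈ w.val := by
    have h1 : w.val.valuation (aeval tL q) = 1 :=
      w.val.valuation_aeval_eq_one hq (w.valuation_lt_one ht) (by simp [hq0])
    rw [← ValuationSubring.valuation_le_one_iff, ← mul_one (w.val.valuation f)]
    rw (occs := .pos [1]) [← h1]
    rw [← map_mul, hf,
      ValuationSubring.valuation_le_one_iff]
    exact w.val.aeval_mem hp ((w.val.valuation_le_one_iff _).1 (w.valuation_lt_one ht).le)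
  have hinj : Function.Injective
      (comap : RZPoint (algebraMap R L) → RZPoint (algebraMap R₀ F)) := by
    intro w w' hw
    have hc : w.val.comap (algebraMap F L) = w'.val.comap (algebraMap F L) :=
      congr_arg RZPoint.val hw
    refine ext_val (le_antisymm (fun f hf ↦ ?_) fun f hf ↦ ?_)
    · obtain ⟨p, q, hp, hq, hq0, h⟩ := hA w hf
      rw [hc] at hp hq
      exact hA' w' hp hq hq0 h
    · obtain ⟨p, q, hp, hq, hq0, h⟩ := hA w' hf
      rw [← hc] at hp hq
      exact hA' w hp hq hq0 h
  have hsurj : Function.Surjective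
      (comap : RZPoint (algebraMap R L) → RZPoint (algebraMap R₀ F)) := by
    intro v
    obtain ⟨W, hW, htW, hlt⟩ := ValuationSubring.exists_of_dominating v hm hmin
      ((coeff_zero_mem_maximalIdeal ht).2 (by simp [h0]))
    have hcoeff (p : R₀[X]) (i : ℕ) : (p.map (algebraMap R₀ F)).coeff i ∈
        W.comap (algebraMap F L) := by
      rw [hW, coeff_map]; exact v.dom_le _
    have hq1 {q : R₀[X]} (hq : IsUnit (aeval t q)) :
        W.valuation (algebraMap R L (aeval t q)) = 1 := by
      rw [haev]
      refine W.valuation_aeval_eq_one (hcoeff q) htW ?_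
      have hu : IsUnit (q.coeff 0) := by
        by_contra hcon
        exact (coeff_zero_mem_maximalIdeal ht).1 hcon hq
      obtain ⟨u, hu⟩ := hu
      have hle (a : R₀) : W.valuation (algebraMap F L (algebraMap R₀ F a)) ≤ 1 := by
        rw [W.valuation_le_one_iff, ← ValuationSubring.mem_comap, hW]
        exact v.dom_le a
      refine le_antisymm (by rw [coeff_map]; exact hle _) ?_
      have h1 : W.valuation (algebraMap F L (algebraMap R₀ F u)) *
          W.valuation (algebraMap F L (algebraMap R₀ F ↑u⁻¹)) = 1 := by
        rw [← map_mul, ← map_mul, ← map_mul]; simp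
      rw [coeff_map, ← hu, ← h1]
      exact mul_le_of_le_one_right' (hle _)
    have hval {r : R} {p q : R₀[X]} (hq : IsUnit (aeval t q)) (h : r * aeval t q = aeval t p) :
        W.valuation (algebraMap R L r) = W.valuation (aeval tL (p.map (algebraMap R₀ F))) := by
      rw [← haev, ← h, map_mul, map_mul, hq1 hq, mul_one]
    refine ⟨ofValuation W (fun r ↦ ?_) fun r hr ↦ ?_, ext_val hW⟩
    · obtain ⟨p, q, hq, h⟩ := hfrac r
      rw [← ValuationSubring.valuation_le_one_iff, hval hq h, ValuationSubring.valuation_le_one_iff]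
      exact W.aeval_mem (hcoeff p) ((W.valuation_le_one_iff _).1 htW.le)
    · obtain ⟨p, q, hq, h⟩ := hfrac r
      rw [hval hq h]
      have hp0 : p.coeff 0 ∈ maximalIdeal R₀ := by
        rw [coeff_zero_mem_maximalIdeal ht, ← h]
        exact Ideal.mul_mem_right _ _ hr
      have h1 := W.valuation_aeval_sub_lt_one (hcoeff p) htW
      have h2 := hlt _ (v.valuation_lt_one hp0)
      rw [coeff_map] at h1
      simpa using Valuation.map_add_lt _ h1 h2
  let e := Equiv.ofBijective _ ⟨hinj, hsurj⟩
  refine ⟨⟨e, continuous_comap, continuous_of_isOpen fun f ↦ ?_⟩⟩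
  have : {v | f ∈ (e.symm v).val} = ⋃ pq : {pq : F[X] × F[X] // pq.2.coeff 0 = 1 ∧
      f * aeval tL pq.2 = aeval tL pq.1}, ((⋂ i ∈ pq.1.1.support,
        {v : RZPoint (algebraMap R₀ F) | pq.1.1.coeff i ∈ v.val}) ∩
        ⋂ i ∈ pq.1.2.support, {v | pq.1.2.coeff i ∈ v.val}) := by
    ext v
    obtain ⟨w, rfl⟩ := e.surjective v
    have aux {p : F[X]} : (∀ i ∈ p.support, p.coeff i ∈ (e w).val) ↔
        ∀ i, p.coeff i ∈ (e w).val := by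
      refine ⟨fun h i ↦ ?_, fun h i _ ↦ h i⟩
      by_cases hi : i ∈ p.support
      · exact h i hi
      · rw [notMem_support_iff.1 hi]; exact zero_mem _
    simp only [Set.mem_ofPred_eq, Set.mem_iUnion, Set.mem_inter_iff, Set.mem_iInter, aux,
      e.symm_apply_apply]
    constructor
    · intro hf
      obtain ⟨p, q, hp, hq, hq0, h⟩ := hA w hf
      exact ⟨⟨(p, q), hq0, h⟩, hp, hq⟩
    · rintro ⟨⟨⟨p, q⟩, hq0, h⟩, hp, hq⟩
      exact hA' w hp hq hq0 h
  change IsOpen {v | f ∈ (e.symm v).val}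
  rw [this]
  exact isOpen_iUnion fun _ ↦ IsOpen.inter
    (isOpen_biInter_finset fun _ _ ↦ isOpen_setOf_mem _)
    (isOpen_biInter_finset fun _ _ ↦ isOpen_setOf_mem _)

end Core

end RZPoint

section UnramifiedLocal

open Polynomial IsLocalRing

theorem Algebra.IsUnramifiedAt.exists_monic_isUnit_derivative {P B R : Type*} [CommRing P]
    [CommRing B] [CommRing R] [Algebra P B] [Algebra B R] [Algebra P R] [IsScalarTower P B R]
    [Algebra.FiniteType P B] (n : Ideal B) [n.IsPrime] [IsLocalization.AtPrime R n]
    [Algebra.IsUnramifiedAt P n] :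
    ∃ (f : P[X]) (t : R), f.Monic ∧ aeval t f = 0 ∧ IsUnit (aeval t (derivative f)) ∧
      ∀ r : R, ∃ p q : P[X], IsUnit (aeval t q) ∧ r * aeval t q = aeval t p := by
  obtain ⟨s, hs, Q, φ, hφ⟩ := Algebra.IsUnramifiedAt.exists_hasStandardEtaleSurjectionOn (R := P) n
  have hsu : IsUnit (algebraMap B R s) := IsLocalization.map_units R (⟨s, hs⟩ : n.primeCompl)
  let ψ : Localization.Away s →ₐ[P] R :=
    { IsLocalization.Away.lift s hsu with
      commutes' p := by
        rw [IsScalarTower.algebraMap_apply P B (Localization.Away s)]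
        change IsLocalization.Away.lift s hsu _ = _
        rw [IsLocalization.Away.lift_eq, ← IsScalarTower.algebraMap_apply] }
  have hψ (b : B) : ψ (algebraMap B _ b) = algebraMap B R b := IsLocalization.Away.lift_eq s hsu b
  let Q' : StandardEtalePresentation P Q.Ring :=
    { P := Q
      x := Q.X
      hasMap := Q.hasMap_X
      lift_bijective := by
        rw [StandardEtalePair.lift_X_left]
        exact Function.bijective_id }
  set t : R := ψ (φ Q.X) with ht
  have hmap : Q.HasMap t := (Q.hasMap_X.map φ).map ψ
  have key (b : B) : ∃ (p : P[X]) (i : ℕ), algebraMap B R b * aeval t Q.g ^ i = aeval t p := by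
    obtain ⟨z, hz⟩ := hφ (algebraMap B _ b)
    obtain ⟨p, i, h⟩ := Q'.exists_mul_aeval_x_g_pow_eq_aeval_x z
    refine ⟨p, i, ?_⟩
    have := congr_arg (fun z ↦ ψ (φ z)) h
    simp only [map_mul, map_pow, hz, hψ] at this
    rwa [← aeval_algHom_apply, ← aeval_algHom_apply, ← aeval_algHom_apply,
      ← aeval_algHom_apply] at this
  refine ⟨Q.f, t, Q.monic_f, hmap.1, StandardEtalePair.HasMap.isUnit_derivative_f Q hmap,
    fun r ↦ ?_⟩
  obtain ⟨⟨b, s⟩, hr⟩ := IsLocalization.surj n.primeCompl r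
  obtain ⟨p, i, hp⟩ := key b
  obtain ⟨q, j, hq⟩ := key s
  refine ⟨p * Q.g ^ j, q * Q.g ^ i, ?_, ?_⟩
  · rw [map_mul, ← hq, map_pow]
    exact ((IsLocalization.map_units R s).mul (hmap.2.pow j)).mul (hmap.2.pow i)
  · simp only [map_mul, ← hq, ← hp, map_pow, ← hr]
    ring

/-- The comparison of Riemann–Zariski spaces along an unramified extension of a normal local ring
with trivial residue field extension. -/
theorem RZPoint.nonempty_homeomorph_of_isUnramifiedAt {P R₀ F B R L : Type u}
    [CommRing P] [CommRing R₀] [IsDomain R₀] [IsIntegrallyClosed R₀] [IsLocalRing R₀]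
    [Field F] [CommRing B] [CommRing R] [IsLocalRing R] [Field L]
    [Algebra P R₀] [Algebra P B] [Algebra P R] [Algebra R₀ F] [Algebra R₀ R] [Algebra R₀ L]
    [Algebra F L] [Algebra B R] [Algebra R L]
    [IsScalarTower P R₀ R] [IsScalarTower P B R] [IsScalarTower R₀ R L] [IsScalarTower R₀ F L]
    [IsFractionRing R₀ F] [IsFractionRing R L] [IsLocalHom (algebraMap R₀ R)]
    [Algebra.FiniteType P B] (n : Ideal B) [n.IsPrime] [IsLocalization.AtPrime R n]
    [Algebra.IsUnramifiedAt P n]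
    (hres : ∀ r : R, ∃ c : P, r - algebraMap P R c ∈ maximalIdeal R) :
    Algebra.IsAlgebraic F L ∧
      Nonempty (RZPoint (algebraMap R L) ≃ₜ RZPoint (algebraMap R₀ F)) := by
  have : IsDomain R := (IsFractionRing.injective R L).isDomain
  have hinj : Function.Injective (algebraMap R₀ R) := by
    have h : Function.Injective (algebraMap R₀ L) := by
      rw [IsScalarTower.algebraMap_eq R₀ F L]
      exact (algebraMap F L).injective.comp (IsFractionRing.injective R₀ F)
    rw [IsScalarTower.algebraMap_eq R₀ R L] at h
    exact Function.Injective.of_comp h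
  have : FaithfulSMul R₀ R := (faithfulSMul_iff_algebraMap_injective R₀ R).2 hinj
  obtain ⟨f, t₀, hf, hf0, hfd, hfr⟩ :=
    Algebra.IsUnramifiedAt.exists_monic_isUnit_derivative (P := P) (R := R) n
  obtain ⟨c, hc⟩ := hres t₀
  set t := t₀ - algebraMap P R c with ht
  let sh (p : P[X]) : R₀[X] := (p.comp (X + C c)).map (algebraMap P R₀)
  have hsh (p : P[X]) : aeval t (sh p) = aeval t₀ p := by
    simp [sh, aeval_comp, ht]
  have hintegral : IsIntegral R₀ t := ⟨sh f, (hf.comp_X_add_C c).map _, by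
    rw [← aeval_def, hsh, hf0]⟩
  have hfrac (r : R) : ∃ p q : R₀[X], IsUnit (aeval t q) ∧ r * aeval t q = aeval t p := by
    obtain ⟨p, q, hq, h⟩ := hfr r
    exact ⟨sh p, sh q, by rwa [hsh], by rwa [hsh, hsh]⟩
  have hmin : minpoly F (algebraMap R L t) = (minpoly R₀ t).map (algebraMap R₀ F) :=
    minpoly.isIntegrallyClosed_eq_field_fractions F L hintegral
  have hder : IsUnit (aeval t (derivative (minpoly R₀ t))) := by
    obtain ⟨w, hw⟩ := minpoly.isIntegrallyClosed_dvd hintegral (p := sh f) (by rw [hsh, hf0])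
    have h1 : aeval t (derivative (sh f)) = aeval t₀ (derivative f) := by
      rw [← hsh]
      simp [sh, derivative_comp]
    rw [hw, derivative_mul, map_add, map_mul, map_mul, minpoly.aeval, zero_mul, add_zero] at h1
    exact isUnit_of_mul_isUnit_left (h1 ▸ hfd)
  have hgen : IntermediateField.adjoin F {algebraMap R L t} = ⊤ := by
    have hmem (p : R₀[X]) : algebraMap R L (aeval t p) ∈
        IntermediateField.adjoin F {algebraMap R L t} := by
      rw [← aeval_algebraMap_apply, ← aeval_map_algebraMap F]
      exact IntermediateField.algebra_adjoin_le_adjoin F _ (aeval_mem_adjoin_singleton F _)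
    have hR (r : R) : algebraMap R L r ∈ IntermediateField.adjoin F {algebraMap R L t} := by
      obtain ⟨p, q, hq, h⟩ := hfrac r
      have hq0 : algebraMap R L (aeval t q) ≠ 0 := (hq.map (algebraMap R L)).ne_zero
      have : algebraMap R L r = algebraMap R L (aeval t p) / algebraMap R L (aeval t q) := by
        rw [eq_div_iff hq0, ← map_mul, h]
      rw [this]
      exact div_mem (hmem p) (hmem q)
    rw [eq_top_iff]
    intro x _
    obtain ⟨a, b, _, rfl⟩ := IsFractionRing.div_surjective (A := R) x
    exact div_mem (hR a) (hR b)
  have halg : Algebra.IsAlgebraic F L := by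
    have h1 : IsIntegral F (algebraMap R L t) :=
      (hintegral.map (IsScalarTower.toAlgHom R₀ R L)).tower_top
    have := IntermediateField.isAlgebraic_adjoin_simple h1
    rw [hgen] at this
    exact (IntermediateField.topEquiv (F := F) (E := L)).isAlgebraic
  exact ⟨halg, nonempty_homeomorph hc (minpoly.monic hintegral) hmin
    (minpoly.aeval _ _) hder hgen hfrac⟩

end UnramifiedLocal

section Coordinates

open IsLocalRing

/-- The tuple `y` of elements of the `k`-algebra `B` defines a map to affine space which is
unramified at the prime `n`. -/
def IsUnramifiedTuple (k : Type*) {B σ : Type*} [CommRing k] [CommRing B] [Algebra k B]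
    (y : σ → B) (n : Ideal B) [n.IsPrime] : Prop :=
  letI := (MvPolynomial.aeval (R := k) y).toRingHom.toAlgebra
  Algebra.IsUnramifiedAt (MvPolynomial σ k) n

/-- The ideal of the origin in affine space. -/
def MvPolynomial.originIdeal (σ k : Type*) [CommRing k] : Ideal (MvPolynomial σ k) :=
  RingHom.ker (MvPolynomial.constantCoeff (R := k) (σ := σ))

instance MvPolynomial.isMaximal_originIdeal (σ k : Type*) [Field k] :
    (originIdeal σ k).IsMaximal :=
  RingHom.ker_isMaximal_of_surjective _ fun a ↦ ⟨C a, constantCoeff_C _ a⟩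

theorem MvPolynomial.originIdeal_eq_span {σ k : Type*} [CommRing k] :
    originIdeal σ k = Ideal.span (Set.range X) := by
  refine le_antisymm (fun p hp ↦ ?_) (Ideal.span_le.2 ?_)
  · rw [← Ideal.Quotient.eq_zero_iff_mem]
    have h : (Ideal.Quotient.mkₐ k (Ideal.span (Set.range (X : σ → MvPolynomial σ k)))) =
        (Algebra.ofId k _).comp (aeval (fun _ : σ ↦ (0 : k))) := by
      ext i
      simp
    have := DFunLike.congr_fun h p
    have h0 : constantCoeff p = 0 := hp
    simpa [h0, MvPolynomial.aeval_zero'] using this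
  · rintro _ ⟨i, rfl⟩
    simp [originIdeal]

theorem Algebra.algebraMap_quotient_bijective_of_isMaximal (k : Type*) {B : Type*} [Field k]
    [IsAlgClosed k] [CommRing B] [Algebra k B] [Algebra.FiniteType k B] (n : Ideal B)
    [n.IsMaximal] : Function.Bijective (algebraMap k (B ⧸ n)) := by
  let := Ideal.Quotient.field n
  have := finite_of_finite_type_of_isJacobsonRing k (B ⧸ n)
  exact IsAlgClosed.algebraMap_bijective_of_isIntegral

theorem Algebra.exists_sub_algebraMap_mem (k : Type*) {B : Type*} [Field k]
    [IsAlgClosed k] [CommRing B] [Algebra k B] [Algebra.FiniteType k B] (n : Ideal B)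
    [n.IsMaximal] (b : B) : ∃ c : k, b - algebraMap k B c ∈ n := by
  obtain ⟨c, hc⟩ := (algebraMap_quotient_bijective_of_isMaximal k n).2 (Ideal.Quotient.mk n b)
  exact ⟨c, by rw [← Ideal.Quotient.eq_zero_iff_mem, map_sub, ← hc, sub_eq_zero]; rfl⟩

variable (k : Type u) [Field k]

/-- The local ring of affine space at the origin. -/
abbrev AffineLocalRing (d : ℕ) : Type u :=
  Localization.AtPrime (MvPolynomial.originIdeal (Fin d) k)

/-- The Riemann–Zariski space of affine space at the origin. -/
abbrev AffineRZ (d : ℕ) : Type u :=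
  RZPoint (algebraMap (AffineLocalRing k d) (FractionRing (MvPolynomial (Fin d) k)))

variable {k}

theorem RZPoint.nonempty_homeomorph_affineRZ [IsAlgClosed k] {B R L : Type u} [CommRing B]
    [IsDomain B] [Algebra k B] [Algebra.FiniteType k B] (n : Ideal B) [n.IsMaximal]
    [CommRing R] [IsLocalRing R] [Algebra B R] [IsLocalization.AtPrime R n]
    [Field L] [Algebra B L] [IsFractionRing B L] [Algebra R L] [IsScalarTower B R L]
    [Algebra k L] [IsScalarTower k B L]
    {d : ℕ} {y : Fin d → B} (hy : ∀ i, y i ∈ n) (hinj : AlgebraicIndependent k y)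
    (hunr : IsUnramifiedTuple k y n) :
    Algebra.trdeg k L = d ∧ Nonempty (RZPoint (algebraMap R L) ≃ₜ AffineRZ k d) := by
  let P := MvPolynomial (Fin d) k
  let 𝔬 := MvPolynomial.originIdeal (Fin d) k
  let R₀ := AffineLocalRing k d
  let F := FractionRing P
  let algPB : Algebra P B := (MvPolynomial.aeval (R := k) y).toRingHom.toAlgebra
  have : Algebra.IsUnramifiedAt P n := hunr
  have hPB (p : P) : algebraMap P B p = MvPolynomial.aeval y p := rfl
  have : IsScalarTower k P B := .of_algebraMap_eq fun c ↦ by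
    rw [hPB, MvPolynomial.algebraMap_eq, MvPolynomial.aeval_C]
  let : Algebra P R := ((algebraMap B R).comp (algebraMap P B)).toAlgebra
  have : IsScalarTower P B R := .of_algebraMap_eq fun _ ↦ rfl
  let : Algebra P L := ((algebraMap B L).comp (algebraMap P B)).toAlgebra
  have : IsScalarTower P B L := .of_algebraMap_eq fun _ ↦ rfl
  have : IsScalarTower P R L := .of_algebraMap_eq fun p ↦ by
    rw [IsScalarTower.algebraMap_apply P B L, IsScalarTower.algebraMap_apply P B R,
      ← IsScalarTower.algebraMap_apply B R L]
  have : IsScalarTower k P L := .of_algebraMap_eq fun p ↦ by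
    rw [IsScalarTower.algebraMap_apply P B L, ← IsScalarTower.algebraMap_apply k P B,
      ← IsScalarTower.algebraMap_apply k B L]
  have hle : 𝔬 ≤ n.comap (algebraMap P B) := by
    change MvPolynomial.originIdeal _ _ ≤ _
    rw [MvPolynomial.originIdeal_eq_span, Ideal.span_le]
    rintro _ ⟨i, rfl⟩
    simpa [hPB] using hy i
  have hcomap : n.comap (algebraMap P B) = 𝔬 :=
    ((MvPolynomial.isMaximal_originIdeal (Fin d) k).eq_of_le
      (Ideal.comap_ne_top _ (Ideal.IsMaximal.ne_top ‹n.IsMaximal›)) hle).symm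
  have hcompl : 𝔬.primeCompl ≤ n.primeCompl.comap (algebraMap P B) := fun p hp hpn ↦
    hp (hle.antisymm hcomap.le ▸ hpn)
  let : Algebra R₀ R := (IsLocalization.map R (algebraMap P B) hcompl : R₀ →+* R).toAlgebra
  have : IsScalarTower P R₀ R := .of_algebraMap_eq fun p ↦
    (IsLocalization.map_eq hcompl p).symm
  let : Algebra R₀ L := ((algebraMap R L).comp (algebraMap R₀ R)).toAlgebra
  have : IsScalarTower R₀ R L := .of_algebraMap_eq fun _ ↦ rfl
  have : IsScalarTower P R₀ L := .of_algebraMap_eq fun p ↦ by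
    rw [IsScalarTower.algebraMap_apply R₀ R L, ← IsScalarTower.algebraMap_apply P R₀ R,
      ← IsScalarTower.algebraMap_apply P R L]
  have hPBinj : Function.Injective (algebraMap P B) := hinj
  have hPLinj : Function.Injective (algebraMap P L) := by
    rw [IsScalarTower.algebraMap_eq P B L]
    exact (IsFractionRing.injective B L).comp hPBinj
  have hnz : 𝔬.primeCompl ≤ nonZeroDivisors P := 𝔬.primeCompl_le_nonZeroDivisors
  have : IsDomain R₀ := IsLocalization.isDomain_localization hnz
  have hR₀L : Function.Injective (algebraMap R₀ L) := by
    rw [injective_iff_map_eq_zero]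
    intro x hx
    obtain ⟨p, s, rfl⟩ := IsLocalization.exists_mk'_eq 𝔬.primeCompl x
    have h := congr_arg (algebraMap R₀ L) (IsLocalization.mk'_spec R₀ p s)
    rw [map_mul, hx, zero_mul, ← IsScalarTower.algebraMap_apply P R₀ L] at h
    rw [(map_eq_zero_iff _ hPLinj).1 h.symm, IsLocalization.mk'_zero]
  let : Algebra F L := (IsFractionRing.lift hR₀L : F →+* L).toAlgebra
  have : IsScalarTower R₀ F L :=
    .of_algebraMap_eq fun x ↦ (IsFractionRing.lift_algebraMap hR₀L x).symm
  have : IsIntegrallyClosed R₀ := isIntegrallyClosed_of_isLocalization R₀ 𝔬.primeCompl hnz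
  have : IsFractionRing R L :=
    IsFractionRing.isFractionRing_of_isDomain_of_isLocalization n.primeCompl R L
  have : Algebra.FiniteType P B := Algebra.FiniteType.of_restrictScalars_finiteType k P B
  have hmem (b : B) : algebraMap B R b ∈ maximalIdeal R ↔ b ∈ n :=
    IsLocalization.AtPrime.to_map_mem_maximal_iff R n b
  have : IsLocalHom (algebraMap R₀ R) := ⟨fun x hx ↦ by
    obtain ⟨p, s, rfl⟩ := IsLocalization.exists_mk'_eq 𝔬.primeCompl x
    rw [IsLocalization.AtPrime.isUnit_mk'_iff R₀ 𝔬]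
    intro hp
    have h := congr_arg (algebraMap R₀ R) (IsLocalization.mk'_spec R₀ p s)
    rw [map_mul, ← IsScalarTower.algebraMap_apply P R₀ R, ← IsScalarTower.algebraMap_apply P R₀ R]
      at h
    have h1 : algebraMap P R p ∈ maximalIdeal R := by
      rw [IsScalarTower.algebraMap_apply P B R, hmem]
      exact hle hp
    have h2 : IsUnit (algebraMap P R s) := by
      rw [IsScalarTower.algebraMap_apply P B R]
      exact IsLocalization.map_units R (⟨_, hcompl s.2⟩ : n.primeCompl)
    exact h1 (h ▸ hx.mul h2)⟩
  have hres (r : R) : ∃ c : P, r - algebraMap P R c ∈ maximalIdeal R := by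
    obtain ⟨b, s, rfl⟩ := IsLocalization.exists_mk'_eq n.primeCompl r
    obtain ⟨β, hβ⟩ := Algebra.exists_sub_algebraMap_mem k n b
    obtain ⟨γ, hγ⟩ := Algebra.exists_sub_algebraMap_mem k n (s : B)
    have hγ0 : γ ≠ 0 := by
      rintro rfl
      exact s.2 (by simpa using hγ)
    refine ⟨MvPolynomial.C (β / γ), ?_⟩
    have hC : algebraMap P R (MvPolynomial.C (β / γ)) =
        algebraMap B R (algebraMap k B (β / γ)) := by
      rw [IsScalarTower.algebraMap_apply P B R, hPB, MvPolynomial.aeval_C]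
    have hs : IsUnit (algebraMap B R s) := IsLocalization.map_units R s
    rw [hC, ← Ideal.unit_mul_mem_iff_mem _ hs, mul_sub, IsLocalization.mk'_spec', ← map_mul,
      ← map_sub, hmem]
    have : b - s * algebraMap k B (β / γ) = (b - algebraMap k B β) -
        (s - algebraMap k B γ) * algebraMap k B (β / γ) := by
      rw [sub_mul, ← map_mul, mul_div_cancel₀ _ hγ0]; ring
    rw [this]
    exact sub_mem hβ (Ideal.mul_mem_right _ _ hγ)
  obtain ⟨halg, hhom⟩ := RZPoint.nonempty_homeomorph_of_isUnramifiedAt (P := P) (R₀ := R₀) (F := F)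
    (R := R) (L := L) n hres
  refine ⟨?_, hhom⟩
  have : Algebra.IsAlgebraic R₀ L := IsFractionRing.comap_isAlgebraic_iff.2 halg
  have : Algebra.IsAlgebraic P R₀ := IsLocalization.isAlgebraic R₀ 𝔬.primeCompl
  have : Algebra.IsAlgebraic P L := Algebra.IsAlgebraic.trans P R₀ L
  have : FaithfulSMul P L := (faithfulSMul_iff_algebraMap_injective P L).2 hPLinj
  rw [← trdeg_add_eq k P (A := L), trdeg_eq_zero (R := P), add_zero,
    MvPolynomial.trdeg_of_isDomain]
  simp

end Coordinates

section Unramified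

open IsLocalRing

/-- In characteristic zero, an algebra essentially of finite type is unramified at a prime `q`
as soon as the residue field extension is algebraic and `q` is locally generated by its
contraction. -/
theorem Algebra.isUnramifiedAt_of_algebraic_of_map {k P B : Type*} [Field k] [CharZero k]
    [CommRing P] [Algebra k P] [CommRing B] [Algebra P B] [Algebra.EssFiniteType P B]
    (q : Ideal B) [q.IsPrime]
    (halg : ∀ b : B, ∃ f : Polynomial P,
      f.map (algebraMap P (B ⧸ q)) ≠ 0 ∧ Polynomial.aeval b f ∈ q)
    (hmap : ∀ b ∈ q, ∃ s ∉ q, s * b ∈ (q.comap (algebraMap P B)).map (algebraMap P B)) :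
    Algebra.IsUnramifiedAt P q := by
  let p := q.under P
  let := Localization.AtPrime.algebraOfLiesOver p q
  refine (Algebra.isUnramifiedAt_iff_map_eq P p q).2 ⟨?_, le_antisymm ?_ ?_⟩
  · have : CharZero p.ResidueField :=
      charZero_of_injective_algebraMap (algebraMap k p.ResidueField).injective
    have hB (b : B) : IsAlgebraic p.ResidueField (algebraMap B q.ResidueField b) := by
      obtain ⟨f, hf, hfb⟩ := halg b
      refine ⟨f.map (algebraMap P p.ResidueField), fun h0 ↦ hf ?_, ?_⟩
      · have h1 : f.map (algebraMap P q.ResidueField) = 0 := by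
          rw [IsScalarTower.algebraMap_eq P p.ResidueField q.ResidueField, ← Polynomial.map_map,
            h0, Polynomial.map_zero]
        rw [IsScalarTower.algebraMap_eq P (B ⧸ q) q.ResidueField, ← Polynomial.map_map] at h1
        exact (Polynomial.map_eq_zero_iff (Ideal.injective_algebraMap_quotient_residueField q)).1 h1
      · rw [Polynomial.aeval_map_algebraMap, Polynomial.aeval_algebraMap_apply,
          Ideal.algebraMap_residueField_eq_zero]
        exact hfb
    have : Algebra.IsAlgebraic p.ResidueField q.ResidueField := ⟨fun x ↦ by
      obtain ⟨a, b, hb, rfl⟩ := IsFractionRing.div_surjective (A := B ⧸ q) x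
      obtain ⟨a, rfl⟩ := Ideal.Quotient.mk_surjective a
      obtain ⟨b, rfl⟩ := Ideal.Quotient.mk_surjective b
      rw [div_eq_mul_inv]
      exact (hB a).mul (hB b).inv⟩
    infer_instance
  · rw [IsScalarTower.algebraMap_eq P B, ← Ideal.map_map,
      ← Localization.AtPrime.map_eq_maximalIdeal]
    exact Ideal.map_mono Ideal.map_comap_le
  · rw [← Localization.AtPrime.map_eq_maximalIdeal, Ideal.map_le_iff_le_comap]
    intro b hb
    obtain ⟨s, hs, hsb⟩ := hmap b hb
    have hu : IsUnit (algebraMap B (Localization.AtPrime q) s) :=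
      IsLocalization.map_units _ (⟨s, hs⟩ : q.primeCompl)
    rw [Ideal.mem_comap, ← Ideal.unit_mul_mem_iff_mem _ hu, ← map_mul,
      IsScalarTower.algebraMap_eq P B, ← Ideal.map_map]
    exact Ideal.mem_map_of_mem _ hsb

end Unramified

section RegularPoint

open IsLocalRing

theorem Ideal.height_le_height_comap {P B : Type*} [CommRing P] [IsNoetherianRing P] [CommRing B]
    [IsNoetherianRing B] (φ : P →+* B) (n : Ideal B) [n.IsPrime]
    (h : ∀ b ∈ n, ∃ s ∉ n, s * b ∈ (n.comap φ).map φ) : n.height ≤ (n.comap φ).height := by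
  classical
  obtain ⟨s, hs, hcard⟩ := (n.comap φ).exists_finset_card_eq_height_of_isNoetherianRing
  have hmin : n ∈ (Ideal.span ((s.image φ : Finset B) : Set B)).minimalPrimes := by
    rw [Finset.coe_image, ← Ideal.map_span]
    refine ⟨⟨inferInstance, Ideal.map_le_iff_le_comap.2 hs.1.2⟩, fun Q ⟨hQ, hsQ⟩ hQn b hb ↦ ?_⟩
    have hle : n.comap φ ≤ Q.comap φ :=
      hs.2 ⟨inferInstance, Ideal.map_le_iff_le_comap.1 hsQ⟩ (Ideal.comap_mono hQn)
    obtain ⟨t, ht, htb⟩ := h b hb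
    exact (hQ.mem_or_mem (Ideal.map_le_iff_le_comap.2 hle htb)).resolve_left fun h ↦ ht (hQn h)
  rw [← hcard]
  exact (Ideal.height_le_card_of_mem_minimalPrimes_span_finset hmin).trans
    (by exact_mod_cast Finset.card_image_le)

theorem algebraicIndependent_of_le_height {k B : Type*} [Field k] [CommRing B]
    [IsNoetherianRing B] [Algebra k B] (n : Ideal B) [n.IsPrime] {d : ℕ} {y : Fin d → B}
    (hy : ∀ i, y i ∈ n) (hspan : ∀ b ∈ n, ∃ s ∉ n, s * b ∈ Ideal.span (Set.range y))
    (hd : (d : ℕ∞) ≤ n.height) : AlgebraicIndependent k y := by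
  change Function.Injective (MvPolynomial.aeval (R := k) y)
  rw [injective_iff_map_eq_zero]
  by_contra! ⟨f, hf, hf0⟩
  let φ : MvPolynomial (Fin d) k ⧸ Ideal.span {f} →+* B :=
    Ideal.Quotient.lift _ (MvPolynomial.aeval (R := k) y).toRingHom fun a ha ↦ by
      obtain ⟨c, rfl⟩ := Ideal.mem_span_singleton.1 ha
      simp [hf]
  have hφ (i : Fin d) : φ (Ideal.Quotient.mk _ (MvPolynomial.X i)) = y i := by
    simp [φ]
  have h1 : n.height ≤ (n.comap φ).height := by
    refine n.height_le_height_comap φ fun b hb ↦ ?_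
    obtain ⟨s, hs, hsb⟩ := hspan b hb
    refine ⟨s, hs, (Ideal.span_le.2 ?_) hsb⟩
    rintro _ ⟨i, rfl⟩
    rw [← hφ]
    exact Ideal.mem_map_of_mem φ (by rw [Ideal.mem_comap, hφ]; exact hy i)
  have h2 : ((n.comap φ).height : WithBot ℕ∞) ≤ _ := Ideal.height_le_ringKrullDim_of_isPrime
  have h3 := ringKrullDim_quotient_succ_le_of_nonZeroDivisor (mem_nonZeroDivisors_of_ne_zero hf0)
  rw [MvPolynomial.ringKrullDim_of_isNoetherianRing, ringKrullDim_eq_zero_of_field, zero_add,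
    Nat.card_fin] at h3
  have h4 : ((d : ℕ∞) : WithBot ℕ∞) + 1 ≤ (d : ℕ∞) :=
    (add_le_add_left ((WithBot.coe_le_coe.2 (hd.trans h1)).trans h2) 1).trans h3
  norm_cast at h4
  omega

theorem IsRegularLocal.exists_generators {B R : Type*} [CommRing B] (n : Ideal B) [n.IsPrime]
    [CommRing R] [IsLocalRing R] [Algebra B R] [IsLocalization.AtPrime R n]
    (hR : IsRegularLocal R) : ∃ (d : ℕ) (y : Fin d → B), (∀ i, y i ∈ n) ∧
      (∀ b ∈ n, ∃ s ∉ n, s * b ∈ Ideal.span (Set.range y)) ∧ (d : ℕ∞) = n.height := by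
  obtain ⟨s, hs, hcard⟩ := hR
  have hmem (b : B) : algebraMap B R b ∈ maximalIdeal R ↔ b ∈ n :=
    IsLocalization.AtPrime.to_map_mem_maximal_iff R n b
  have hfrac (r : R) : ∃ (b : B) (t : n.primeCompl), r * algebraMap B R t = algebraMap B R b := by
    obtain ⟨⟨b, t⟩, h⟩ := IsLocalization.surj n.primeCompl r
    exact ⟨b, t, h⟩
  choose num den hnum using hfrac
  let y (i : Fin s.card) : B := num (s.equivFin.symm i)
  have hspan : Ideal.span (Set.range fun i ↦ algebraMap B R (y i)) = maximalIdeal R := by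
    refine le_antisymm (Ideal.span_le.2 ?_) (hs ▸ Ideal.span_le.2 fun r hr ↦ ?_)
    · rintro _ ⟨i, rfl⟩
      change algebraMap B R (num _) ∈ maximalIdeal R
      rw [← hnum, ← hs]
      exact Ideal.mul_mem_right _ _ (Ideal.subset_span (s.equivFin.symm i).2)
    · rw [SetLike.mem_coe, ← Ideal.mul_unit_mem_iff_mem _ (IsLocalization.map_units R (den r)),
        hnum]
      exact Ideal.subset_span ⟨s.equivFin ⟨r, hr⟩, by simp [y]⟩
  refine ⟨s.card, y, fun i ↦ ?_, fun b hb ↦ ?_, ?_⟩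
  · rw [← hmem, ← hspan]
    exact Ideal.subset_span ⟨i, rfl⟩
  · have h := (hmem b).2 hb
    have hr : Set.range (fun i ↦ algebraMap B R (y i)) = algebraMap B R '' Set.range y :=
      Set.range_comp (algebraMap B R) y
    rw [← hspan, hr, ← Ideal.map_span,
      IsLocalization.algebraMap_mem_map_algebraMap_iff n.primeCompl]
      at h
    exact h
  · rw [IsLocalization.AtPrime.ringKrullDim_eq_height n R] at hcard
    exact_mod_cast hcard

theorem IsRegularLocal.exists_isUnramifiedTuple {k B R : Type*} [Field k] [IsAlgClosed k]
    [CharZero k] [CommRing B] [Algebra k B] [Algebra.FiniteType k B] (n : Ideal B) [n.IsMaximal]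
    [CommRing R] [IsLocalRing R] [Algebra B R] [IsLocalization.AtPrime R n]
    (hR : IsRegularLocal R) : ∃ (d : ℕ) (y : Fin d → B), (∀ i, y i ∈ n) ∧
      AlgebraicIndependent k y ∧ IsUnramifiedTuple k y n := by
  obtain ⟨d, y, hy, hspan, hd⟩ := hR.exists_generators n
  have : IsNoetherianRing B := Algebra.FiniteType.isNoetherianRing k B
  refine ⟨d, y, hy, algebraicIndependent_of_le_height n hy hspan hd.le, ?_⟩
  let P := MvPolynomial (Fin d) k
  let : Algebra P B := (MvPolynomial.aeval (R := k) y).toRingHom.toAlgebra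
  have hPB (p : P) : algebraMap P B p = MvPolynomial.aeval y p := rfl
  have : IsScalarTower k P B := .of_algebraMap_eq fun c ↦ by
    rw [hPB, MvPolynomial.algebraMap_eq, MvPolynomial.aeval_C]
  have : Algebra.FiniteType P B := Algebra.FiniteType.of_restrictScalars_finiteType k P B
  refine Algebra.isUnramifiedAt_of_algebraic_of_map (k := k) n (fun b ↦ ?_) fun b hb ↦ ?_
  · obtain ⟨c, hc⟩ := Algebra.exists_sub_algebraMap_mem k n b
    refine ⟨Polynomial.X - Polynomial.C (algebraMap k P c), ?_, ?_⟩
    · rw [Polynomial.map_sub, Polynomial.map_X, Polynomial.map_C]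
      exact Polynomial.X_sub_C_ne_zero _
    · rwa [map_sub, Polynomial.aeval_X, Polynomial.aeval_C, ← IsScalarTower.algebraMap_apply]
  · obtain ⟨s, hs, hsb⟩ := hspan b hb
    refine ⟨s, hs, Ideal.span_le.2 ?_ hsb⟩
    rintro _ ⟨i, rfl⟩
    have hX : algebraMap P B (MvPolynomial.X i) = y i := by simp [hPB]
    rw [← hX]
    exact Ideal.mem_map_of_mem _ (by rw [Ideal.mem_comap, hX]; exact hy i)

end RegularPoint

section Divisor

open IsLocalRing

theorem IsRegularLocal.of_isDiscreteValuationRing (R : Type*) [CommRing R] [IsDomain R]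
    [IsLocalRing R] [IsPrincipalIdealRing R] (hR : ¬ IsField R) : IsRegularLocal R := by
  obtain ⟨ϖ, hϖ⟩ := (IsPrincipalIdealRing.principal (maximalIdeal R)).principal
  exact ⟨{ϖ}, by simpa using hϖ.symm, by simp [IsPrincipalIdealRing.ringKrullDim_eq_one R hR]⟩

theorem IsIntegrallyClosed.isPrincipalIdealRing_localization {C : Type*} [CommRing C]
    [IsDomain C] [IsNoetherianRing C] [IsIntegrallyClosed C] (p : Ideal C) [p.IsPrime]
    (hp : p.height ≤ 1) : IsPrincipalIdealRing (Localization.AtPrime p) := by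
  have : IsNoetherianRing (Localization.AtPrime p) :=
    IsLocalization.isNoetherianRing p.primeCompl _ inferInstance
  have : IsIntegrallyClosed (Localization.AtPrime p) :=
    isIntegrallyClosed_of_isLocalization _ p.primeCompl p.primeCompl_le_nonZeroDivisors
  have hdim : Ring.KrullDimLE 1 (Localization.AtPrime p) := by
    rw [Ring.krullDimLE_iff, IsLocalization.AtPrime.ringKrullDim_eq_height p]
    exact_mod_cast hp
  refine ((tfae_of_isNoetherianRing_of_isLocalRing_of_isDomain (Localization.AtPrime p)).out
    0 3 rfl rfl).2 ⟨inferInstance, fun P hP _ ↦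
      eq_maximalIdeal (P.isMaximal_of_isPrime_of_ne_bot hP)⟩

theorem algebraicIndependent_finCons_of_mem {k C : Type*} [Field k] [CommRing C] [IsDomain C]
    [Algebra k C] (p : Ideal C) [p.IsPrime] {u : C} (hu : u ∈ p) (hu0 : u ≠ 0) {e : ℕ}
    {y : Fin e → C} (hy : AlgebraicIndependent k fun i ↦ Ideal.Quotient.mk p (y i)) :
    AlgebraicIndependent k (Fin.cons u y : Fin (e + 1) → C) := by
  have haeval (q : MvPolynomial (Fin e) k) :
      MvPolynomial.aeval (fun i ↦ Ideal.Quotient.mk p (y i)) q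
      = Ideal.Quotient.mk p (MvPolynomial.aeval y q) :=
    (MvPolynomial.aeval_algebraMap_apply (R := k) (A := C) (C ⧸ p) y q)
  have hy' : AlgebraicIndependent k y := by
    refine (injective_iff_map_eq_zero _).2 fun q hq ↦ ?_
    exact (injective_iff_map_eq_zero _).1 hy q ((haeval q).trans (by rw [hq, map_zero]))
  rw [algebraicIndependent_equiv' (finSuccEquiv e)
    (f := fun o : Option (Fin e) ↦ o.elim u y), hy'.option_iff_transcendental]
  · rintro ⟨F, hF0, hF⟩
    obtain ⟨G, hFG, hG⟩ := F.exists_eq_pow_rootMultiplicity_mul_and_not_dvd hF0 0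
    rw [Polynomial.C_0, sub_zero, Polynomial.X_dvd_iff] at hG
    have hGu : Polynomial.aeval u G = 0 := by
      rw [hFG] at hF
      simpa [hu0] using hF
    apply hG
    have hmem : (G.coeff 0 : C) ∈ p := by
      rw [← G.divX_mul_X_add, map_add, map_mul, Polynomial.aeval_X, Polynomial.aeval_C] at hGu
      have : (G.coeff 0 : C) = - (Polynomial.aeval u G.divX * u) := by
        rw [eq_neg_iff_add_eq_zero, add_comm]
        exact hGu
      rw [this]
      exact neg_mem (Ideal.mul_mem_left _ _ hu)
    obtain ⟨q, hq⟩ := (Algebra.adjoin_range_eq_range_aeval k y).le (G.coeff 0).2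
    have hq0 : q = 0 := by
      refine (injective_iff_map_eq_zero _).1 hy q ((haeval q).trans ?_)
      rw [Ideal.Quotient.eq_zero_iff_mem]
      exact hq ▸ hmem
    apply Subtype.ext
    exact hq.symm.trans (by simp [hq0])
  · funext i
    cases i using Fin.cases <;> rfl

/-- A nonzero nonunit of a normal affine domain lies in a prime at which some transcendence
basis of the function field is unramified. -/
theorem IsIntegrallyClosed.exists_isUnramifiedTuple (k : Type*) {C : Type*} [Field k] [CharZero k]
    [CommRing C] [IsDomain C] [IsIntegrallyClosed C] [Algebra k C] [Algebra.FiniteType k C]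
    {x : C} (hx0 : x ≠ 0) (hx : ¬ IsUnit x) :
    ∃ (p : Ideal C) (_ : p.IsPrime) (d : ℕ) (y : Fin d → C), x ∈ p ∧
      AlgebraicIndependent k y ∧ IsUnramifiedTuple k y p := by
  have : IsNoetherianRing C := Algebra.FiniteType.isNoetherianRing k C
  obtain ⟨p, hp⟩ := Ideal.nonempty_minimalPrimes (I := Ideal.span {x})
    (by rwa [Ne, Ideal.span_singleton_eq_top])
  have : p.IsPrime := hp.1.1
  have hxp : x ∈ p := hp.1.2 (Ideal.mem_span_singleton_self x)
  have hht : p.height ≤ 1 := by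
    rw [← Finset.coe_singleton] at hp
    simpa using Ideal.height_le_card_of_mem_minimalPrimes_span_finset hp
  have := isPrincipalIdealRing_localization p hht
  have hfield : ¬ IsField (Localization.AtPrime p) := fun h ↦ by
    have h1 : algebraMap C (Localization.AtPrime p) x ∈ maximalIdeal _ :=
      (IsLocalization.AtPrime.to_map_mem_maximal_iff _ p x).2 hxp
    rw [isField_iff_maximalIdeal_eq.1 h, Ideal.mem_bot,
      IsLocalization.to_map_eq_zero_iff _ p.primeCompl_le_nonZeroDivisors] at h1
    exact hx0 h1
  obtain ⟨d, u, hu, hspan, hd⟩ :=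
    (IsRegularLocal.of_isDiscreteValuationRing _ hfield).exists_generators p
  obtain rfl : d = 1 := by
    have h1 := IsPrincipalIdealRing.ringKrullDim_eq_one _ hfield
    rw [IsLocalization.AtPrime.ringKrullDim_eq_height p, ← hd] at h1
    exact_mod_cast h1
  have hu0 : u 0 ≠ 0 := fun h0 ↦ by
    obtain ⟨s, hs, hsx⟩ := hspan x hxp
    have : Ideal.span (Set.range u) = ⊥ := by simp [h0]
    rw [this, Ideal.mem_bot, mul_eq_zero, or_iff_left hx0] at hsx
    exact hs (hsx ▸ zero_mem p)
  obtain ⟨e, g, hg, hfin⟩ := exists_finite_inj_algHom_of_fg k (C ⧸ p)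
  choose y hy using fun i ↦ Ideal.Quotient.mk_surjective (g (MvPolynomial.X i))
  have hgy : MvPolynomial.aeval (fun i ↦ Ideal.Quotient.mk p (y i)) = g := by
    ext i
    simp [hy]
  have hind : AlgebraicIndependent k fun i ↦ Ideal.Quotient.mk p (y i) := by
    rw [algebraicIndependent_iff_injective_aeval, hgy]
    exact hg
  refine ⟨p, hp.1.1, e + 1, Fin.cons (u 0) y, hxp,
    algebraicIndependent_finCons_of_mem p (hu 0) hu0 hind, ?_⟩
  let P := MvPolynomial (Fin (e + 1)) k
  let : Algebra P C :=
    (MvPolynomial.aeval (R := k) (Fin.cons (u 0) y : Fin (e + 1) → C)).toRingHom.toAlgebra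
  have hPC (p : P) : algebraMap P C p = MvPolynomial.aeval (Fin.cons (u 0) y : Fin (e + 1) → C) p :=
    rfl
  have hPq (q : P) : algebraMap P (C ⧸ p) q =
      Ideal.Quotient.mk p (MvPolynomial.aeval (Fin.cons (u 0) y : Fin (e + 1) → C) q) := rfl
  have : IsScalarTower k P C := .of_algebraMap_eq fun c ↦ by
    rw [hPC, MvPolynomial.algebraMap_eq, MvPolynomial.aeval_C]
  have : Algebra.FiniteType P C := Algebra.FiniteType.of_restrictScalars_finiteType k P C
  refine Algebra.isUnramifiedAt_of_algebraic_of_map (k := k) p (fun b ↦ ?_) fun b hb ↦ ?_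
  · obtain ⟨f, hf, hfb⟩ := hfin.to_isIntegral (Ideal.Quotient.mk p b)
    refine ⟨f.map (MvPolynomial.rename Fin.succ).toRingHom, ((hf.map _).map _).ne_zero, ?_⟩
    rw [← Ideal.Quotient.eq_zero_iff_mem, ← hfb, Polynomial.aeval_def, Polynomial.eval₂_map,
      Polynomial.hom_eval₂]
    congr 1
    rw [← hgy]
    ext i
    · exact (hPq (MvPolynomial.rename Fin.succ (MvPolynomial.C _))).trans (by simp)
    · exact (hPq (MvPolynomial.rename Fin.succ (MvPolynomial.X _))).trans (by simp)
  · obtain ⟨s, hs, hsb⟩ := hspan b hb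
    refine ⟨s, hs, Ideal.span_le.2 ?_ hsb⟩
    rintro _ ⟨i, rfl⟩
    obtain rfl := Subsingleton.elim i 0
    have hX : algebraMap P C (MvPolynomial.X 0) = u 0 := by simp [hPC]
    have hX' : MvPolynomial.X 0 ∈ p.comap (algebraMap P C) := by
      rw [Ideal.mem_comap, hX]
      exact hu 0
    have h := Ideal.mem_map_of_mem (algebraMap P C) hX'
    rwa [hX] at h

end Divisor

theorem Subalgebra.exists_isIntegrallyClosed_of_fg {k K : Type*} [Field k] [CharZero k] [Field K]
    [Algebra k K] (B : Subalgebra k K) [Algebra.FiniteType k B] [IsFractionRing B K] :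
    ∃ C : Subalgebra k K, B ≤ C ∧ (∀ x ∈ C, IsIntegral B x) ∧ Algebra.FiniteType k C ∧
      IsIntegrallyClosed C ∧ IsFractionRing C K := by
  obtain ⟨e, g, hg, hfin⟩ := exists_finite_inj_algHom_of_fg k B
  let P := MvPolynomial (Fin e) k
  let F := FractionRing P
  let : Algebra P B := g.toRingHom.toAlgebra
  have : IsScalarTower k P B := .of_algebraMap_eq fun c ↦ (g.commutes c).symm
  have : Module.Finite P B := hfin
  let : Algebra P K := ((algebraMap B K).comp (algebraMap P B)).toAlgebra
  have : IsScalarTower P B K := .of_algebraMap_eq fun _ ↦ rfl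
  have : IsScalarTower k P K := .of_algebraMap_eq fun c ↦ by
    rw [IsScalarTower.algebraMap_apply P B K, ← IsScalarTower.algebraMap_apply k P B,
      ← IsScalarTower.algebraMap_apply k B K]
  have hPK : Function.Injective (algebraMap P K) := by
    rw [IsScalarTower.algebraMap_eq P B K]
    exact (IsFractionRing.injective B K).comp hg
  let : Algebra F K := (IsFractionRing.lift hPK : F →+* K).toAlgebra
  have : IsScalarTower P F K :=
    .of_algebraMap_eq fun x ↦ (IsFractionRing.lift_algebraMap hPK x).symm
  have : Algebra.QuasiFinite P K := .trans _ B _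
  have : Algebra.QuasiFinite F K := .of_restrictScalars P F K
  have : FiniteDimensional F K := .of_quasiFinite
  have : CharZero F := charZero_of_injective_algebraMap (algebraMap k F).injective
  have : Module.Finite P (integralClosure P K) := IsIntegralClosure.finite P F K _
  refine ⟨(integralClosure P K).restrictScalars k, fun x hx ↦ ?_, fun x hx ↦ ?_, ?_, ?_, ?_⟩
  · exact (Algebra.IsIntegral.isIntegral (R := P) (⟨x, hx⟩ : B)).algebraMap
  · exact IsIntegral.tower_top (R := P) hx
  · have : Algebra.FiniteType k (integralClosure P K) :=
      Algebra.FiniteType.trans (S := P) inferInstance inferInstance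
    exact this
  · exact integralClosure.isIntegrallyClosedOfFiniteExtension F
  · exact integralClosure.isFractionRing_of_finite_extension F K

/-- The translation automorphism of affine space. -/
def MvPolynomial.translation {k σ : Type*} [CommRing k] (c : σ → k) :
    MvPolynomial σ k ≃ₐ[k] MvPolynomial σ k :=
  .ofAlgHom (aeval fun i ↦ X i - C (c i)) (aeval fun i ↦ X i + C (c i))
    (by ext i; simp [MvPolynomial.algebraMap_eq]) (by ext i; simp [MvPolynomial.algebraMap_eq])

theorem MvPolynomial.aeval_comp_translation {k σ B : Type*} [CommRing k] [CommRing B] [Algebra k B]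
    (c : σ → k) (y : σ → B) :
    (aeval y).comp (translation c).toAlgHom = aeval fun i ↦ y i - algebraMap k B (c i) := by
  ext i
  simp [translation]

theorem AlgebraicIndependent.sub_algebraMap {k σ B : Type*} [CommRing k] [CommRing B] [Algebra k B]
    {y : σ → B} (hy : AlgebraicIndependent k y) (c : σ → k) :
    AlgebraicIndependent k fun i ↦ y i - algebraMap k B (c i) := by
  rw [algebraicIndependent_iff_injective_aeval, ← MvPolynomial.aeval_comp_translation]
  exact Function.Injective.comp (g := MvPolynomial.aeval y) hy
    (MvPolynomial.translation c).injective

theorem IsUnramifiedTuple.sub_algebraMap {k σ B : Type*} [CommRing k] [CommRing B] [Algebra k B]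
    {y : σ → B} {n : Ideal B} [n.IsPrime] (hy : IsUnramifiedTuple k y n) (c : σ → k) :
    IsUnramifiedTuple k (fun i ↦ y i - algebraMap k B (c i)) n := by
  have key (z : σ → B) : IsUnramifiedTuple k z n ↔
      ((algebraMap B (Localization.AtPrime n)).comp
        (MvPolynomial.aeval (R := k) z).toRingHom).FormallyUnramified := by
    let : Algebra (MvPolynomial σ k) B := (MvPolynomial.aeval (R := k) z).toRingHom.toAlgebra
    exact (RingHom.formallyUnramified_algebraMap
      (R := MvPolynomial σ k) (S := Localization.AtPrime n)).symm
  rw [key] at hy ⊢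
  rw [← MvPolynomial.aeval_comp_translation]
  exact .comp (f := (MvPolynomial.translation c).toRingEquiv.toRingHom)
    (.of_surjective (MvPolynomial.translation c).surjective) hy

theorem IsUnramifiedTuple.exists_isMaximal {k C : Type*} [Field k] [IsAlgClosed k] [CommRing C]
    [Algebra k C] [Algebra.FiniteType k C] {d : ℕ} {y : Fin d → C} {p : Ideal C} [p.IsPrime]
    (hy : IsUnramifiedTuple k y p) (hinj : AlgebraicIndependent k y) :
    ∃ (n : Ideal C) (_ : n.IsMaximal) (y' : Fin d → C), p ≤ n ∧ (∀ i, y' i ∈ n) ∧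
      AlgebraicIndependent k y' ∧ IsUnramifiedTuple k y' n := by
  obtain ⟨n, hn, hpn, hun⟩ : ∃ (n : Ideal C) (_ : n.IsMaximal),
      p ≤ n ∧ IsUnramifiedTuple k y n := by
    let P := MvPolynomial (Fin d) k
    let : Algebra P C := (MvPolynomial.aeval (R := k) y).toRingHom.toAlgebra
    have : IsScalarTower k P C :=
      .of_algebraMap_eq fun c ↦ ((MvPolynomial.aeval (R := k) y).commutes c).symm
    have : Algebra.FiniteType P C := .of_restrictScalars_finiteType k P C
    have : Algebra.IsUnramifiedAt P p := hy
    obtain ⟨f, hf, hfu⟩ := Algebra.exists_formallyUnramified_of_isUnramifiedAt (R := P) p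
    have : IsJacobsonRing C := isJacobsonRing_of_finiteType (A := k)
    rw [← IsJacobsonRing.out ‹_› (Ideal.IsPrime.isRadical ‹p.IsPrime›), Ideal.jacobson,
      Submodule.mem_sInf] at hf
    push Not at hf
    obtain ⟨n, ⟨hpn, hn⟩, hfn⟩ := hf
    exact ⟨n, hn, hpn, Algebra.basicOpen_subset_unramifiedLocus_iff.mpr hfu
      (show (⟨n, hn.isPrime⟩ : PrimeSpectrum C) ∈ PrimeSpectrum.basicOpen f from hfn)⟩
  choose c hc using fun i ↦ Algebra.exists_sub_algebraMap_mem k n (y i)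
  exact ⟨n, hn, _, hpn, hc, hinj.sub_algebraMap c, hun.sub_algebraMap c⟩

namespace RZPoint

section Dominating

variable {R S K : Type u} [CommRing R] [IsLocalRing R] [CommRing S] [IsLocalRing S] [Field K]
  {φ : R →+* K} {ψ : S →+* K}

/-- A valuation dominating `S` dominates every local ring dominated by `S`. -/
def ofDominated (h : ∀ a, φ a ∈ ψ.range)
    (h' : ∀ a ∈ IsLocalRing.maximalIdeal R, φ a ∈ ψ '' IsLocalRing.maximalIdeal S)
    (w : RZPoint ψ) : RZPoint φ :=
  ofValuation w.val (fun a ↦ by obtain ⟨b, hb⟩ := h a; exact hb ▸ w.dom_le b)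
    (fun a ha ↦ by obtain ⟨b, hb, hb'⟩ := h' a ha; exact hb' ▸ w.valuation_lt_one hb)

theorem isEmbedding_ofDominated (h : ∀ a, φ a ∈ ψ.range)
    (h' : ∀ a ∈ IsLocalRing.maximalIdeal R, φ a ∈ ψ '' IsLocalRing.maximalIdeal S) :
    Topology.IsEmbedding (ofDominated h h') where
  eq_induced := by
    refine Eq.trans ?_ induced_generateFrom_eq.symm
    refine congrArg TopologicalSpace.generateFrom (Set.ext fun s ↦ ⟨?_, ?_⟩)
    · rintro ⟨f, rfl⟩
      exact ⟨_, ⟨f, rfl⟩, rfl⟩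
    · rintro ⟨_, ⟨f, rfl⟩, rfl⟩
      exact ⟨f, rfl⟩
  injective v w hvw := ext_val (congrArg val hvw :)

end Dominating

end RZPoint

theorem ValuationSubring.mem_of_isIntegral {k K : Type*} [CommRing k] [Field K] [Algebra k K]
    (V : ValuationSubring K) {B : Subalgebra k K} (hB : ∀ b ∈ B, b ∈ V) {x : K}
    (hx : IsIntegral B x) : x ∈ V := by
  let : Algebra B V := (Subring.inclusion (S := B.toSubring) (T := V.toSubring) hB).toAlgebra
  have : IsScalarTower B V K := .of_algebraMap_eq fun _ ↦ rfl
  obtain ⟨y, rfl⟩ := IsIntegrallyClosed.isIntegral_iff.1 (hx.tower_top (A := V))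
  exact y.2

theorem ValuationSubring.exists_isIntegrallyClosed_dominating {k A K : Type*} [Field k] [CharZero k]
    [CommRing A] [IsDomain A] [Algebra k A] [Algebra.FiniteType k A] [Field K] [Algebra A K]
    [IsFractionRing A K] [Algebra k K] [IsScalarTower k A K] (V : ValuationSubring K)
    (hAV : ∀ a, algebraMap A K a ∈ V) {m : Ideal A} (hm : m ≠ ⊥)
    (hmV : ∀ a ∈ m, V.valuation (algebraMap A K a) < 1) (T : Finset K) (hT : ∀ t ∈ T, t ∈ V) :
    ∃ C : Subalgebra k K, Algebra.FiniteType k C ∧ IsIntegrallyClosed C ∧ IsFractionRing C K ∧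
      (∀ a, algebraMap A K a ∈ C) ∧ (∀ t ∈ T, t ∈ C) ∧
      ∃ x : C, x ≠ 0 ∧ ¬ IsUnit x ∧ ∀ a ∈ m, ∃ c : C, algebraMap A K a = c * x := by
  classical
  have : IsNoetherianRing A := Algebra.FiniteType.isNoetherianRing k A
  have hinj : Function.Injective (algebraMap A K) := IsFractionRing.injective A K
  obtain ⟨s, hs⟩ : m.FG := IsNoetherian.noetherian m
  have hsm (g) (hg : g ∈ s) : g ∈ m := hs ▸ Submodule.subset_span hg
  have hs0 : s.Nonempty := by
    rw [Finset.nonempty_iff_ne_empty]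
    rintro rfl
    exact hm (by simpa using hs.symm)
  obtain ⟨x, hxs, hmax⟩ := s.exists_max_image (fun g ↦ V.valuation (algebraMap A K g)) hs0
  have hx0 : algebraMap A K x ≠ 0 := by
    intro hx
    refine hm (hs ▸ Submodule.span_eq_bot.2 fun g hg ↦ ?_)
    simpa [hx, map_eq_zero_iff _ hinj] using hmax g hg
  let W : Subalgebra k K := { V.toSubring with
    algebraMap_mem' := fun c ↦ by
      rw [IsScalarTower.algebraMap_apply k A K]
      exact hAV _ }
  let T' : Finset K := T ∪ s.image fun g ↦ algebraMap A K g / algebraMap A K x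
  let B : Subalgebra k K := (IsScalarTower.toAlgHom k A K).range ⊔ Algebra.adjoin k (T' : Set K)
  have hAB (a) : algebraMap A K a ∈ B := le_sup_left (α := Subalgebra k K) ⟨a, rfl⟩
  have hTB (t) (ht : t ∈ T') : t ∈ B :=
    le_sup_right (α := Subalgebra k K) (Algebra.subset_adjoin ht)
  have hBW : B ≤ W := by
    refine sup_le (by rintro _ ⟨a, rfl⟩; exact hAV a) (Algebra.adjoin_le fun t ht ↦ ?_)
    obtain ht | ht := Finset.mem_union.1 (Finset.mem_coe.1 ht)
    · exact hT t ht
    · obtain ⟨g, hg, rfl⟩ := Finset.mem_image.1 ht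
      change _ ∈ V
      rw [← V.valuation_le_one_iff, map_div₀]
      exact div_le_one_of_le₀ (hmax g hg) zero_le
  have : Algebra.FiniteType k B := by
    rw [← Subalgebra.fg_iff_finiteType]
    refine .sup ?_ (Subalgebra.fg_adjoin_finset T')
    rw [← Algebra.map_top]
    exact .map _ Algebra.FiniteType.out
  have : IsFractionRing B K := by
    refine .of_field _ _ fun z ↦ ?_
    obtain ⟨a, b, -, rfl⟩ := IsFractionRing.div_surjective (A := A) z
    exact ⟨⟨_, hAB a⟩, ⟨_, hAB b⟩, rfl⟩
  obtain ⟨C, hBC, hintegral, hft, hic, hfr⟩ := B.exists_isIntegrallyClosed_of_fg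
  refine ⟨C, hft, hic, hfr, fun a ↦ hBC (hAB a),
    fun t ht ↦ hBC (hTB t (Finset.mem_union_left _ ht)), ⟨algebraMap A K x, hBC (hAB x)⟩,
    fun h ↦ hx0 (congrArg Subtype.val h), ?_, fun a ha ↦ ?_⟩
  · intro hu
    obtain ⟨⟨c, hc⟩, hxc⟩ := hu.exists_left_inv
    have hcV := (V.valuation_le_one_iff c).2 (V.mem_of_isIntegral hBW (hintegral c hc))
    have hxc : c * algebraMap A K x = 1 := congrArg Subtype.val hxc
    have := congrArg V.valuation hxc
    rw [map_mul, map_one] at this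
    exact ((mul_le_of_le_one_left' hcV).trans_lt (hmV x (hsm x hxs))).ne this
  · rw [← hs] at ha
    induction ha using Submodule.span_induction with
    | mem g hg => exact ⟨⟨_, hBC (hTB _ (Finset.mem_union_right _
        (Finset.mem_image_of_mem _ hg)))⟩, (div_mul_cancel₀ _ hx0).symm⟩
    | zero => exact ⟨0, by simp⟩
    | add a b _ _ ha hb =>
      obtain ⟨c, hc⟩ := ha
      obtain ⟨d, hd⟩ := hb
      exact ⟨c + d, by rw [map_add, hc, hd]; push_cast; ring⟩
    | smul r a _ ha =>
      obtain ⟨c, hc⟩ := ha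
      exact ⟨⟨_, hBC (hAB r)⟩ * c, by rw [smul_eq_mul, map_mul, hc]; push_cast; ring⟩

theorem RZPoint.exists_subset_homeomorph (k : Type u) {A R K : Type u} [Field k] [IsAlgClosed k]
    [CharZero k] [CommRing A] [IsDomain A] [Algebra k A] [Algebra.FiniteType k A] (m : Ideal A)
    [m.IsMaximal] [CommRing R] [IsLocalRing R] [Algebra A R] [IsLocalization.AtPrime R m] [Field K]
    [Algebra A K] [IsFractionRing A K] [Algebra R K] [IsScalarTower A R K]
    (hR : IsRegularLocal R) {U : Set (RZPoint (algebraMap R K))} (hU : IsOpen U)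
    (hU' : U.Nonempty) : ∃ V ⊆ U, Nonempty (V ≃ₜ RZPoint (algebraMap R K)) := by
  have hAR (v : RZPoint (algebraMap R K)) (a : A) : algebraMap A K a ∈ v.val := by
    rw [IsScalarTower.algebraMap_apply A R K]
    exact v.dom_le _
  obtain ⟨v, hv⟩ := hU'
  by_cases hm : m = ⊥
  · have hsub : Subsingleton (RZPoint (algebraMap R K)) := by
      have htop (v : RZPoint (algebraMap R K)) : v.val = ⊤ := by
        have hA : IsField A := Ring.isField_iff_maximal_bot.2 (hm ▸ ‹m.IsMaximal›)
        refine ValuationSubring.ext _ _ fun z ↦ iff_of_true ?_ trivial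
        obtain ⟨a, rfl⟩ := IsFractionRing.surjective_iff_isField.2 hA z
        exact hAR v a
      exact ⟨fun v w ↦ ext_val ((htop v).trans (htop w).symm)⟩
    obtain rfl : U = Set.univ := 
      Set.eq_univ_of_forall fun w ↦ Subsingleton.elim v w ▸ hv
    exact ⟨Set.univ, subset_rfl, ⟨Homeomorph.Set.univ _⟩⟩
  let : Algebra k K := ((algebraMap A K).comp (algebraMap k A)).toAlgebra
  have : IsScalarTower k A K := .of_algebraMap_eq fun _ ↦ rfl
  obtain ⟨T, hT, hTU⟩ := exists_finset_subset hU hv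
  have hmv (a : A) (ha : a ∈ m) : v.val.valuation (algebraMap A K a) < 1 := by
    rw [IsScalarTower.algebraMap_apply A R K]
    exact v.valuation_lt_one ((IsLocalization.AtPrime.to_map_mem_maximal_iff R m a).2 ha)
  obtain ⟨C, _, _, _, hAC, hTC, x, hx0, hxu, hxm⟩ :=
    v.val.exists_isIntegrallyClosed_dominating (k := k) (hAR v) hm hmv T hT
  obtain ⟨p, _, e, y, hxp, hy, hyp⟩ := IsIntegrallyClosed.exists_isUnramifiedTuple k hx0 hxu
  obtain ⟨n, _, z, hpn, hzn, hz, hzu⟩ := hyp.exists_isMaximal hy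
  let S := Localization.AtPrime n
  have hn (c : n.primeCompl) : IsUnit (algebraMap C K c) :=
    .mk0 _ fun h ↦ c.2 (by
      rw [(map_eq_zero_iff _ (IsFractionRing.injective C K)).1 h]
      exact n.zero_mem)
  let : Algebra S K := (IsLocalization.lift hn).toAlgebra
  have : IsScalarTower C S K := .of_algebraMap_eq fun c ↦ (IsLocalization.lift_eq hn c).symm
  let j : A →+* C := (algebraMap A K).codRestrict C.toSubring hAC
  have hmn : m = n.comap j := by
    refine Ideal.IsMaximal.eq_of_le ‹_› (Ideal.comap_ne_top j (Ideal.IsPrime.ne_top')) fun a ha ↦ ?_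
    obtain ⟨c, hc⟩ := hxm a ha
    have : j a = c * x := Subtype.ext hc
    rw [Ideal.mem_comap, this]
    exact n.mul_mem_left c (hpn hxp)
  have hj (s : m.primeCompl) : IsUnit ((algebraMap C S).comp j s) :=
    IsLocalization.map_units S (⟨j s, fun h ↦ s.2 (hmn.ge h)⟩ : n.primeCompl)
  let ρ : R →+* S := IsLocalization.lift hj
  have hρ (a : R) : algebraMap S K (ρ a) = algebraMap R K a := by
    refine RingHom.congr_fun (f := (algebraMap S K).comp ρ) (g := algebraMap R K) ?_ a
    refine IsLocalization.ringHom_ext m.primeCompl (RingHom.ext fun a ↦ ?_)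
    simp only [RingHom.comp_apply, ρ, IsLocalization.lift_eq]
    rw [← IsScalarTower.algebraMap_apply A R K, ← IsScalarTower.algebraMap_apply C S K]
    rfl
  have hρm : IsLocalRing.maximalIdeal R ≤ (IsLocalRing.maximalIdeal S).comap ρ := by
    rw [← IsLocalization.AtPrime.map_eq_maximalIdeal m R, Ideal.map_le_iff_le_comap]
    intro a ha
    rw [Ideal.mem_comap, Ideal.mem_comap, IsLocalization.lift_eq]
    exact (IsLocalization.AtPrime.to_map_mem_maximal_iff S n _).2 (hmn.le ha)
  obtain ⟨d, w, hwm, hw, hwu⟩ := hR.exists_isUnramifiedTuple (k := k) m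
  obtain ⟨hd, ⟨f⟩⟩ := nonempty_homeomorph_affineRZ (R := R) (L := K) m hwm hw hwu
  obtain ⟨he, ⟨g⟩⟩ := nonempty_homeomorph_affineRZ (R := S) (L := K) n hzn hz hzu
  obtain rfl : d = e := by exact_mod_cast hd.symm.trans he
  have hι := isEmbedding_ofDominated (φ := algebraMap R K) (ψ := algebraMap S K)
    (fun a ↦ ⟨ρ a, hρ a⟩) (fun a ha ↦ ⟨ρ a, hρm ha, hρ a⟩)
  refine ⟨_, ?_, ⟨hι.toHomeomorph.symm.trans (g.trans f.symm)⟩⟩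
  rintro _ ⟨u, rfl⟩
  refine hTU fun t ht ↦ ?_
  have := u.dom_le (algebraMap C S ⟨t, hTC t ht⟩)
  rwa [← IsScalarTower.algebraMap_apply C S K] at this

/-- Let `X` be an algebraic variety over an algebraically closed field
`k` of characteristic zero, and let `x ∈ X` be a regular closed point.  Then `RZ(X,x)`
is self-homeomorphic: every non-empty open subset `U` of `RZ(X,x)` contains a subset `V`
which, with the subspace topology, is homeomorphic to `RZ(X,x)`. -/
theorem statement_13 {k : Type u} [Field k] [IsAlgClosed k] [CharZero k]
    (X : Scheme.{u}) [IsIntegral X] (sπ : X ⟶ Spec (CommRingCat.of k))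
    [IsSeparated sπ] [LocallyOfFiniteType sπ] [QuasiCompact sπ]
    (x : X) (hx : IsClosed ({x} : Set X)) (hxreg : IsRegularLocal (X.presheaf.stalk x)) :
    ∀ U : Set (RZ X x), IsOpen U → U.Nonempty →
      ∃ V : Set (RZ X x), V ⊆ U ∧ Nonempty (↥V ≃ₜ RZ X x) := by
  intro U hU hU'
  obtain ⟨W, hW, hxW, -⟩ := exists_isAffineOpen_mem_and_subset (TopologicalSpace.Opens.mem_top x)
  have : Nonempty W := ⟨⟨x, hxW⟩⟩
  let θ : k →+* Γ(X, W) := (sπ.appLE ⊤ W le_top).hom.comp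
    (Scheme.ΓSpecIso (CommRingCat.of k)).inv.hom
  let : Algebra k Γ(X, W) := θ.toAlgebra
  have : Algebra.FiniteType k Γ(X, W) :=
    (sπ.finiteType_appLE (isAffineOpen_top _) hW le_top).comp
      (.of_surjective _ (ConcreteCategory.bijective_of_isIso
        (Scheme.ΓSpecIso (CommRingCat.of k)).inv).2)
  let y : W := ⟨x, hxW⟩
  let : Algebra Γ(X, W) (X.presheaf.stalk x) := X.presheaf.algebra_section_stalk y
  have : IsScalarTower Γ(X, W) (X.presheaf.stalk x) X.functionField :=
    functionField_isScalarTower X W y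
  have := hW.primeIdealOf_isMaximal_of_isClosed y hx
  have : IsLocalization.AtPrime (X.presheaf.stalk x) (hW.primeIdealOf y).asIdeal :=
    hW.isLocalization_stalk y
  have := functionField_isFractionRing_of_isAffineOpen X W hW
  exact RZPoint.exists_subset_homeomorph k (hW.primeIdealOf y).asIdeal hxreg hU hU'

end
end

section
/- Let (T, ≤) be a tree (rooted non-metric ℝ-tree) and let τ, τ' be two distinct points of T. Then the image of any injective continuous map γ : [0,1] → T (with T carrying the weak tree topology) such that γ(0) = τ and γ(1) = τ' is exactly the segment [τ, τ']. -/
/-- `(T,≤)` is a *tree* (a rooted nonmetric ℝ-tree): there is a unique smallest element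
(the root); every down-set `{σ | σ ≤ τ}` is order-isomorphic to a real interval; every
totally ordered convex subset is order-isomorphic to a real interval; and every nonempty
subset admits an infimum. -/
structure IsTreePO (T : Type*) [PartialOrder T] : Prop where
  exists_root : ∃ τ₀ : T, ∀ τ, τ₀ ≤ τ
  below_iso : ∀ τ : T, ∃ s : Set ℝ, s.OrdConnected ∧ Nonempty (Set.Iic τ ≃o s)
  chain_iso : ∀ C : Set T, IsChain (· ≤ ·) C → C.OrdConnected →
    ∃ s : Set ℝ, s.OrdConnected ∧ Nonempty (C ≃o s)
  exists_inf : ∀ S : Set T, S.Nonempty → ∃ τ : T, IsGLB S τ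

/-- The segment `[τ,τ'] = {σ | τ∧τ' ≤ σ ≤ τ} ∪ {σ | τ∧τ' ≤ σ ≤ τ'}`, where `τ∧τ'`
is the infimum of `{τ,τ'}` (unique when it exists). -/
def treeSegment {T : Type*} [PartialOrder T] (τ τ' : T) : Set T :=
  {σ | ∃ w, IsGLB {τ, τ'} w ∧ w ≤ σ ∧ (σ ≤ τ ∨ σ ≤ τ')}

/-- The *weak tree topology*: the topology generated by the sets
`U_τ(τ') = {σ ≠ τ : [τ,σ] ∩ [τ,τ'] ≠ {τ}}` (the open sets determined by tangent
vectors at the points of `T`). -/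
def weakTreeTopology (T : Type*) [PartialOrder T] : TopologicalSpace T :=
  TopologicalSpace.generateFrom
    {U | ∃ τ τ' : T, τ' ≠ τ ∧
      U = {σ | σ ≠ τ ∧ treeSegment τ σ ∩ treeSegment τ τ' ≠ {τ}}}

open Set

namespace IsTreePO

variable {T : Type*} [PartialOrder T]

theorem le_total_of_le (hT : IsTreePO T) {a b c : T} (ha : a ≤ c) (hb : b ≤ c) :
    a ≤ b ∨ b ≤ a := by
  obtain ⟨s, -, ⟨e⟩⟩ := hT.below_iso c
  exact (le_total (e ⟨a, ha⟩) (e ⟨b, hb⟩)).imp e.le_iff_le.1 e.le_iff_le.1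

theorem exists_meet (hT : IsTreePO T) (a b : T) :
    ∃ w, IsGLB {a, b} w ∧ w ≤ a ∧ w ≤ b ∧ ∀ v, v ≤ a → v ≤ b → v ≤ w := by
  obtain ⟨w, hw⟩ := hT.exists_inf {a, b} (insert_nonempty _ _)
  refine ⟨w, hw, hw.1 (by simp), hw.1 (by simp), fun v hva hvb => hw.2 ?_⟩
  simp [lowerBounds, hva, hvb]

/-- Two points represent the same tangent vector at `p` iff neither lies above `p`, or both lie
above a common point strictly above `p`. -/
theorem segment_inter_ne_singleton_iff (hT : IsTreePO T) {p x y : T} :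
    treeSegment p x ∩ treeSegment p y ≠ {p} ↔
      (¬ p ≤ x ∧ ¬ p ≤ y) ∨ ∃ r, p < r ∧ r ≤ x ∧ r ≤ y := by
  obtain ⟨u, hu, hup, hux, hu'⟩ := hT.exists_meet p x
  obtain ⟨v, hv, hvp, hvy, hv'⟩ := hT.exists_meet p y
  have mem_x : ∀ r, r ∈ treeSegment p x ↔ u ≤ r ∧ (r ≤ p ∨ r ≤ x) := fun r =>
    ⟨fun ⟨w, hw, h⟩ => hw.unique hu ▸ h, fun h => ⟨u, hu, h⟩⟩
  have mem_y : ∀ r, r ∈ treeSegment p y ↔ v ≤ r ∧ (r ≤ p ∨ r ≤ y) := fun r =>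
    ⟨fun ⟨w, hw, h⟩ => hw.unique hv ▸ h, fun h => ⟨v, hv, h⟩⟩
  have hp : p ∈ treeSegment p x ∩ treeSegment p y :=
    ⟨(mem_x p).2 ⟨hup, .inl le_rfl⟩, (mem_y p).2 ⟨hvp, .inl le_rfl⟩⟩
  constructor
  · intro h
    obtain ⟨r, ⟨hrx, hry⟩, hrp⟩ : ∃ r ∈ treeSegment p x ∩ treeSegment p y, r ≠ p := by
      by_contra! hall
      exact h (Subset.antisymm hall (singleton_subset_iff.2 hp))
    rw [mem_x] at hrx
    rw [mem_y] at hry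
    by_cases hpx : p ≤ x
    · have hpr : p < r := lt_of_le_of_ne ((hu' p le_rfl hpx).trans hrx.1) hrp.symm
      exact .inr ⟨r, hpr, hrx.2.resolve_left hpr.not_ge, hry.2.resolve_left hpr.not_ge⟩
    by_cases hpy : p ≤ y
    · have hpr : p < r := lt_of_le_of_ne ((hv' p le_rfl hpy).trans hry.1) hrp.symm
      exact .inr ⟨r, hpr, hrx.2.resolve_left hpr.not_ge, hry.2.resolve_left hpr.not_ge⟩
    exact .inl ⟨hpx, hpy⟩
  · rintro (⟨hpx, hpy⟩ | ⟨r, hpr, hrx, hry⟩) h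
    · rcases hT.le_total_of_le hup hvp with huv | hvu
      · have : v ∈ treeSegment p x ∩ treeSegment p y :=
          ⟨(mem_x v).2 ⟨huv, .inl hvp⟩, (mem_y v).2 ⟨le_rfl, .inl hvp⟩⟩
        rw [h, mem_singleton_iff] at this
        exact hpy (this ▸ hvy)
      · have : u ∈ treeSegment p x ∩ treeSegment p y :=
          ⟨(mem_x u).2 ⟨le_rfl, .inl hup⟩, (mem_y u).2 ⟨hvu, .inl hup⟩⟩
        rw [h, mem_singleton_iff] at this
        exact hpx (this ▸ hux)
    · have : r ∈ treeSegment p x ∩ treeSegment p y :=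
        ⟨(mem_x r).2 ⟨hup.trans hpr.le, .inr hrx⟩, (mem_y r).2 ⟨hvp.trans hpr.le, .inr hry⟩⟩
      rw [h, mem_singleton_iff] at this
      exact hpr.ne' this

theorem segment_inter_ne_singleton_trans (hT : IsTreePO T) {p x y z : T}
    (hxy : treeSegment p x ∩ treeSegment p y ≠ {p})
    (hyz : treeSegment p y ∩ treeSegment p z ≠ {p}) :
    treeSegment p x ∩ treeSegment p z ≠ {p} := by
  rw [hT.segment_inter_ne_singleton_iff] at *
  rcases hxy with ⟨hx, hy⟩ | ⟨r, hr, hrx, hry⟩ <;> rcases hyz with ⟨hy', hz⟩ | ⟨s, hs, hsy, hsz⟩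
  · exact .inl ⟨hx, hz⟩
  · exact absurd (hs.le.trans hsy) hy
  · exact absurd (hr.le.trans hry) hy'
  · rcases hT.le_total_of_le hry hsy with h | h
    · exact .inr ⟨r, hr, hrx, h.trans hsz⟩
    · exact .inr ⟨s, hs, h.trans hrx, hsz⟩

theorem segment_inter_self_ne_singleton (hT : IsTreePO T) {p x : T} (h : x ≠ p) :
    treeSegment p x ∩ treeSegment p x ≠ {p} := by
  rw [hT.segment_inter_ne_singleton_iff]
  by_cases hpx : p ≤ x
  · exact .inr ⟨x, lt_of_le_of_ne hpx h.symm, le_rfl, le_rfl⟩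
  · exact .inl ⟨hpx, hpx⟩

theorem segment_inter_eq_singleton_of_mem (hT : IsTreePO T) {p a b : T}
    (hp : p ∈ treeSegment a b) : treeSegment p a ∩ treeSegment p b = {p} := by
  by_contra h
  obtain ⟨w, hw, hwp, hpab⟩ := hp
  rcases hT.segment_inter_ne_singleton_iff.1 h with ⟨ha, hb⟩ | ⟨r, hr, hra, hrb⟩
  · exact hpab.elim ha hb
  · exact hr.not_ge ((hw.2 (by simp [lowerBounds, hra, hrb])).trans hwp)

/-- Preconnected sets for the weak tree topology are convex. -/
theorem segment_subset_of_isPreconnected (hT : IsTreePO T) {K : Set T}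
    (hK : @IsPreconnected T (weakTreeTopology T) K) {a b : T} (ha : a ∈ K) (hb : b ∈ K) :
    treeSegment a b ⊆ K := by
  let _ := weakTreeTopology T
  intro p hp
  by_contra hpK
  have ne_p : ∀ x ∈ K, x ≠ p := fun x hx h => hpK (h ▸ hx)
  let U : T → Set T := fun q => {σ | σ ≠ p ∧ treeSegment p σ ∩ treeSegment p q ≠ {p}}
  have isOpen_U : ∀ q, q ≠ p → IsOpen (U q) := fun q hq =>
    TopologicalSpace.isOpen_generateFrom_of_mem ⟨p, q, hq, rfl⟩
  have mem_U : ∀ x ∈ K, x ∈ U x := fun x hx =>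
    ⟨ne_p x hx, hT.segment_inter_self_ne_singleton (ne_p x hx)⟩
  let V : Set T := ⋃ q ∈ {q | q ≠ p ∧ q ∉ U a}, U q
  have isOpen_V : IsOpen V := isOpen_biUnion fun q hq => isOpen_U q hq.1
  have mem_V : ∀ x ∈ K, x ∉ U a → x ∈ V := fun x hx hxa =>
    mem_biUnion (show x ∈ {q | q ≠ p ∧ q ∉ U a} from ⟨ne_p x hx, hxa⟩) (mem_U x hx)
  have hba : b ∉ U a := fun h =>
    h.2 ((inter_comm _ _).trans (hT.segment_inter_eq_singleton_of_mem hp))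
  obtain ⟨x, -, hxa, hxV⟩ := hK (U a) V (isOpen_U a (ne_p a ha)) isOpen_V
    (fun x hx => (em (x ∈ U a)).imp id (mem_V x hx)) ⟨a, ha, mem_U a ha⟩ ⟨b, hb, mem_V b hb hba⟩
  obtain ⟨q, hq, hxq⟩ := mem_iUnion₂.1 hxV
  refine hq.2 ⟨hq.1, hT.segment_inter_ne_singleton_trans ?_ hxa.2⟩
  rw [inter_comm]
  exact hxq.2

/-- Any three points of a tree have a median. -/
theorem exists_median (hT : IsTreePO T) (x y z : T) :
    ∃ m, m ∈ treeSegment x y ∧ m ∈ treeSegment y z ∧ m ∈ treeSegment x z := by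
  obtain ⟨u, hu, hux, huy, -⟩ := hT.exists_meet x y
  obtain ⟨v, hv, hvy, hvz, -⟩ := hT.exists_meet y z
  obtain ⟨w, hw, hwx, hwz, -⟩ := hT.exists_meet x z
  rcases hT.le_total_of_le huy hvy with huv | hvu
  · rcases hT.le_total_of_le hwz hvz with hwv | hvw
    · exact ⟨v, ⟨u, hu, huv, .inr hvy⟩, ⟨v, hv, le_rfl, .inl hvy⟩, ⟨w, hw, hwv, .inr hvz⟩⟩
    · exact ⟨w, ⟨u, hu, huv.trans hvw, .inl hwx⟩, ⟨v, hv, hvw, .inr hwz⟩,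
        ⟨w, hw, le_rfl, .inl hwx⟩⟩
  · rcases hT.le_total_of_le hux hwx with huw | hwu
    · exact ⟨w, ⟨u, hu, huw, .inl hwx⟩, ⟨v, hv, hvu.trans huw, .inr hwz⟩,
        ⟨w, hw, le_rfl, .inl hwx⟩⟩
    · exact ⟨u, ⟨u, hu, le_rfl, .inl hux⟩, ⟨v, hv, hvu, .inl huy⟩, ⟨w, hw, hwu, .inl hux⟩⟩

end IsTreePO

/-- Let `(T,≤)` be a tree and `τ ≠ τ'` two points of `T`.  The image of
any injective continuous map `γ : [0,1] → T` (with `T` carrying the weak tree topology)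
with `γ 0 = τ` and `γ 1 = τ'` is exactly the segment `[τ,τ']`. -/
theorem statement_14 {T : Type*} [PartialOrder T] (hT : IsTreePO T) {τ τ' : T}
    (hne : τ ≠ τ') (γ : unitInterval → T)
    (hcont : @Continuous _ _ _ (weakTreeTopology T) γ)
    (hinj : Function.Injective γ) (h0 : γ 0 = τ) (h1 : γ 1 = τ') :
    Set.range γ = treeSegment τ τ' := by
  let _ := weakTreeTopology T
  apply Subset.antisymm
  · rintro _ ⟨t, rfl⟩
    obtain ⟨m, hm₁, hm₂, hm⟩ := hT.exists_median τ (γ t) τ'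
    obtain ⟨r, hr, hrm⟩ := hT.segment_subset_of_isPreconnected
      (isPreconnected_Iic.image γ hcont.continuousOn)
      ⟨0, t.2.1, h0⟩ (mem_image_of_mem γ (mem_Iic.2 le_rfl)) hm₁
    obtain ⟨s, hs, hsm⟩ := hT.segment_subset_of_isPreconnected
      (isPreconnected_Ici.image γ hcont.continuousOn)
      (mem_image_of_mem γ (mem_Ici.2 le_rfl)) ⟨1, t.2.2, h1⟩ hm₂
    have hrs : r = s := hinj (hrm.trans hsm.symm)
    have hrt : r = t := le_antisymm hr (hrs ▸ hs)
    rwa [← hrt, hrm]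
  · exact hT.segment_subset_of_isPreconnected (isPreconnected_range hcont) ⟨0, h0⟩ ⟨1, h1⟩
end

section
/- Any arcwise connected subspace of a tree (rooted non-metric ℝ-tree with the weak tree topology) is itself a tree: there is a partial order on the subspace making it a tree whose weak tree topology coincides with the subspace topology. -/
/-- A topological space `Z` *is a tree* if there is a partial order on `Z` making it a
tree (rooted nonmetric ℝ-tree) whose weak tree topology coincides with the topology
of `Z`. -/
def IsTopologicalTree (Z : Type*) [tZ : TopologicalSpace Z] : Prop :=
  ∃ po : PartialOrder Z, @IsTreePO Z po ∧ @weakTreeTopology Z po = tZ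

/-- A betweenness relation of tree type: `B a x b` says that `x` lies on the segment from `a`
to `b`. -/
structure IsTreeBtw {X : Type*} (B : X → X → X → Prop) : Prop where
  left : ∀ a b, B a a b
  symm : ∀ {a x b}, B a x b → B b x a
  eq_of_self : ∀ {a x}, B a x a → x = a
  trans : ∀ {a x b y}, B a x b → B a y x → B a y b ∧ B y x b
  total : ∀ {a x b y}, B a x b → B a y b → B a x y ∨ B a y x
  median : ∀ a b c, ∃ m, B a m b ∧ B b m c ∧ B a m c

namespace IsTreeBtw

variable {X : Type*} {B : X → X → X → Prop}

theorem right (h : IsTreeBtw B) (a b : X) : B a b b := h.symm (h.left b a)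

theorem antisymm (h : IsTreeBtw B) {a x y : X} (h₁ : B a x y) (h₂ : B a y x) : x = y :=
  h.eq_of_self (h.trans h₁ h₂).2

/-- A point of a segment splits it into two segments. -/
theorem split (h : IsTreeBtw B) {a m b x : X} (hm : B a m b) (hx : B a x b) :
    B a x m ∨ B m x b :=
  (h.total hm hx).symm.imp id fun h₁ => (h.trans hx h₁).2

/-- `x` lies on the segment from `a` to `b` as soon as it lies on the segment from an
intermediate point to `b`. -/
theorem extend (h : IsTreeBtw B) {a m b x : X} (hm : B a m b) (hx : B m x b) :
    B a x b ∧ B a m x :=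
  have h₁ := h.trans (h.symm hm) (h.symm hx)
  ⟨h.symm h₁.1, h.symm h₁.2⟩

/-- The partial order with root `r` attached to a betweenness relation. -/
abbrev rootedOrder (h : IsTreeBtw B) (r : X) : PartialOrder X where
  le x y := B r x y
  le_refl x := h.right r x
  le_trans _ _ _ h₁ h₂ := (h.trans h₂ h₁).1
  le_antisymm _ _ h₁ h₂ := h.antisymm h₁ h₂

theorem isGLB_median (h : IsTreeBtw B) {r a b m : X} (h₁ : B r m a) (h₂ : B r m b)
    (h₃ : B a m b) : @IsGLB X (h.rootedOrder r).toLE {a, b} m := by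
  let := h.rootedOrder r
  refine ⟨?_, fun y hy => ?_⟩
  · rintro x (rfl | rfl)
    exacts [h₁, h₂]
  · have ya : B r y a := hy (Or.inl rfl)
    have yb : B r y b := hy (Or.inr rfl)
    change B r y m
    rcases h.total ya h₁ with h₄ | h₄
    · exact h₄
    · have h₅ : B m y a := (h.trans ya h₄).2
      have h₆ : B m y b := (h.trans yb h₄).2
      have h₇ : B y m b := (h.trans h₃ (h.symm h₅)).2
      rw [h.antisymm (h.symm h₆) (h.symm h₇)]
      exact h.right r m

theorem treeSegment_rootedOrder (h : IsTreeBtw B) (r a b : X) :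
    @treeSegment X (h.rootedOrder r) a b = {x | B a x b} := by
  let := h.rootedOrder r
  obtain ⟨m, h₁, h₂, h₃⟩ := h.median r a b
  have hm := h.isGLB_median h₁ h₃ h₂
  ext x
  constructor
  · rintro ⟨w, hw, hwx, hx⟩
    obtain rfl := hm.unique hw
    change B r m x at hwx
    rcases hx with hx | hx
    · exact h.symm (h.extend (h.symm h₂) (h.trans hx hwx).2).1
    · exact (h.extend h₂ (h.trans hx hwx).2).1
  · intro hx
    rcases h.split h₂ hx with h₄ | h₄
    · have h₅ := h.extend h₁ (h.symm h₄)
      exact ⟨m, hm, h₅.2, Or.inl h₅.1⟩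
    · have h₅ := h.extend h₃ h₄
      exact ⟨m, hm, h₅.2, Or.inr h₅.1⟩

/-- A subset containing the segments between its points inherits the betweenness relation. -/
theorem restrict (h : IsTreeBtw B) {S : Set X} (hS : ∀ a ∈ S, ∀ b ∈ S, ∀ x, B a x b → x ∈ S) :
    IsTreeBtw fun a x b : S => B a x b where
  left a b := h.left a b
  symm h₁ := h.symm h₁
  eq_of_self h₁ := Subtype.ext (h.eq_of_self h₁)
  trans h₁ h₂ := h.trans h₁ h₂
  total h₁ h₂ := h.total h₁ h₂
  median a b c :=
    let ⟨m, h₁, h₂⟩ := h.median a b c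
    ⟨⟨m, hS a a.2 b b.2 m h₁⟩, h₁, h₂⟩

end IsTreeBtw

/-- `y` and `a` lie in the same direction from `x`. -/
def SameDir {X : Type*} (B : X → X → X → Prop) (x y a : X) : Prop :=
  ∃ z, z ≠ x ∧ B x z y ∧ B x z a

/-- The topology generated by the directions at all points. -/
abbrev btwTopology {X : Type*} (B : X → X → X → Prop) : TopologicalSpace X :=
  TopologicalSpace.generateFrom {U | ∃ x a, a ≠ x ∧ U = {y | SameDir B x y a}}

namespace IsTreeBtw

variable {X : Type*} {B : X → X → X → Prop}

theorem sameDir_refl (h : IsTreeBtw B) {x a : X} (ha : a ≠ x) : SameDir B x a a :=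
  ⟨a, ha, h.right x a, h.right x a⟩

theorem sameDir_symm {x a b : X} (hab : SameDir B x a b) : SameDir B x b a :=
  let ⟨z, hz, h₁, h₂⟩ := hab
  ⟨z, hz, h₂, h₁⟩

theorem sameDir_trans (h : IsTreeBtw B) {x a b c : X} (hab : SameDir B x a b)
    (hbc : SameDir B x b c) : SameDir B x a c := by
  obtain ⟨z, hz, h₁, h₂⟩ := hab
  obtain ⟨w, hw, h₃, h₄⟩ := hbc
  rcases h.total h₂ h₃ with h₅ | h₅
  · exact ⟨z, hz, h₁, (h.trans h₄ h₅).1⟩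
  · exact ⟨w, hw, (h.trans h₁ h₅).1, h₄⟩

theorem ne_of_sameDir (h : IsTreeBtw B) {x a b : X} (hab : SameDir B x a b) : a ≠ x := by
  rintro rfl
  obtain ⟨z, hz, h₁, -⟩ := hab
  exact hz (h.eq_of_self h₁)

theorem not_sameDir (h : IsTreeBtw B) {x a b : X} (hx : B a x b) : ¬ SameDir B x a b := by
  rintro ⟨z, hz, h₁, h₂⟩
  exact hz (h.antisymm (h.symm h₂) (h.symm (h.trans hx (h.symm h₁)).2))

theorem btw_of_not_sameDir (h : IsTreeBtw B) {x a b : X} (hab : ¬ SameDir B x a b) :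
    B a x b := by
  obtain ⟨m, h₁, h₂, h₃⟩ := h.median x a b
  by_cases hm : m = x
  · exact hm ▸ h₂
  · exact (hab ⟨m, hm, h₁, h₃⟩).elim

theorem weakTreeTopology_eq (h : IsTreeBtw B) [PartialOrder X]
    (hB : ∀ a b : X, treeSegment a b = {x | B a x b}) :
    weakTreeTopology X = btwTopology B := by
  have key : ∀ x a : X, {y | y ≠ x ∧ treeSegment x y ∩ treeSegment x a ≠ {x}} =
      {y | SameDir B x y a} := by
    intro x a
    ext y
    simp only [hB, Set.mem_ofPred_eq]
    constructor
    · rintro ⟨-, hne⟩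
      by_contra hcon
      refine hne (Set.eq_singleton_iff_unique_mem.2 ⟨⟨h.left x y, h.left x a⟩, ?_⟩)
      rintro z ⟨h₁, h₂⟩
      by_contra hz
      exact hcon ⟨z, hz, h₁, h₂⟩
    · intro hy
      refine ⟨h.ne_of_sameDir hy, fun heq => ?_⟩
      obtain ⟨z, hz, h₁, h₂⟩ := hy
      have hmem : z ∈ ({x} : Set X) := heq ▸ ⟨h₁, h₂⟩
      exact hz hmem
  simp only [weakTreeTopology, btwTopology, key]

theorem isOpen_sameDir {x a : X} (ha : a ≠ x) : @IsOpen X (btwTopology B) {y | SameDir B x y a} :=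
  TopologicalSpace.isOpen_generateFrom_of_mem ⟨x, a, ha, rfl⟩

/-- A preconnected set contains the segments between its points. -/
theorem mem_of_isPreconnected (h : IsTreeBtw B) {C : Set X}
    (hC : @IsPreconnected X (btwTopology B) C) {a b x : X} (ha : a ∈ C) (hb : b ∈ C)
    (hx : B a x b) : x ∈ C := by
  let := btwTopology B
  by_contra hxC
  have hne : ∀ y ∈ C, y ≠ x := fun y hy e => hxC (e ▸ hy)
  let V : Set X := ⋃ z : {z // z ≠ x ∧ ¬ SameDir B x z a}, {y | SameDir B x y z}
  have hV : IsOpen V := isOpen_iUnion fun z => isOpen_sameDir z.2.1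
  obtain ⟨y, -, hy₁, hy₂⟩ := hC {y | SameDir B x y a} V (isOpen_sameDir (hne a ha)) hV
    (fun y hy => by
      by_cases hya : SameDir B x y a
      · exact Or.inl hya
      · exact Or.inr (Set.mem_iUnion.2 ⟨⟨y, hne y hy, hya⟩, h.sameDir_refl (hne y hy)⟩))
    ⟨a, ha, h.sameDir_refl (hne a ha)⟩
    ⟨b, hb, Set.mem_iUnion.2 ⟨⟨b, hne b hb, h.not_sameDir (h.symm hx)⟩,
      h.sameDir_refl (hne b hb)⟩⟩
  obtain ⟨z, hz⟩ := Set.mem_iUnion.1 hy₂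
  exact z.2.2 (h.sameDir_trans (sameDir_symm hz) hy₁)

theorem btwTopology_restrict (h : IsTreeBtw B) {S : Set X}
    (hS : ∀ a ∈ S, ∀ b ∈ S, ∀ x, B a x b → x ∈ S) :
    btwTopology (fun a x b : S => B a x b) =
      TopologicalSpace.induced Subtype.val (btwTopology B) := by
  have key : ∀ x y a : S, SameDir (fun a x b : S => B a x b) x y a ↔ SameDir B x y a := by
    intro x y a
    constructor
    · rintro ⟨z, hz, h₁, h₂⟩
      exact ⟨z, fun e => hz (Subtype.ext e), h₁, h₂⟩
    · rintro ⟨z, hz, h₁, h₂⟩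
      exact ⟨⟨z, hS x x.2 y y.2 z h₁⟩, fun e => hz (congrArg Subtype.val e), h₁, h₂⟩
  apply le_antisymm
  · unfold btwTopology
    rw [induced_generateFrom_eq]
    apply le_generateFrom
    rintro _ ⟨_, ⟨x, a, ha, rfl⟩, rfl⟩
    rcases Set.eq_empty_or_nonempty (Subtype.val ⁻¹' {y | SameDir B x y a} : Set S) with he | ⟨b, hb⟩
    · rw [he]
      exact @isOpen_empty _ (_)
    have hb : SameDir B x b a := hb
    by_cases hx : x ∈ S
    · have hbx : b ≠ ⟨x, hx⟩ := fun e => h.ne_of_sameDir hb (congrArg Subtype.val e)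
      convert isOpen_sameDir (B := fun a x b : S => B a x b) hbx using 1
      ext y
      exact ⟨fun hy => (key _ _ _).2 (h.sameDir_trans hy (sameDir_symm hb)),
        fun hy => h.sameDir_trans ((key _ _ _).1 hy) hb⟩
    · convert @isOpen_univ S (_) using 1
      ext y
      refine ⟨fun _ => trivial, fun _ => ?_⟩
      by_contra hy
      exact hx (hS y y.2 b b.2 x (h.btw_of_not_sameDir fun hyb => hy (h.sameDir_trans hyb hb)))
  · apply le_generateFrom
    rintro _ ⟨x, a, ha, rfl⟩
    refine ⟨_, isOpen_sameDir (B := B) fun e : (a : X) = x => ha (Subtype.ext e), ?_⟩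
    ext y
    exact (key x y a).symm

end IsTreeBtw

/-- The set `C` with the relation `le` is a copy of an interval of the real line. -/
def IsRealInterval {X : Type*} (le : X → X → Prop) (C : Set X) : Prop :=
  ∃ f : X → ℝ, (∀ x ∈ C, ∀ y ∈ C, (f x ≤ f y ↔ le x y)) ∧ (f '' C).OrdConnected

namespace IsRealInterval

variable {X Y : Type*} {le : X → X → Prop} {C D : Set X}

theorem mono (h : IsRealInterval le D) (hCD : C ⊆ D)
    (hC : ∀ x ∈ C, ∀ y ∈ C, ∀ z ∈ D, le x z → le z y → z ∈ C) : IsRealInterval le C := by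
  obtain ⟨f, hf, ho⟩ := h
  refine ⟨f, fun x hx y hy => hf x (hCD hx) y (hCD hy), ⟨?_⟩⟩
  rintro _ ⟨x, hx, rfl⟩ _ ⟨y, hy, rfl⟩ t ht
  obtain ⟨z, hz, rfl⟩ := ho.out ⟨x, hCD hx, rfl⟩ ⟨y, hCD hy, rfl⟩ ht
  exact ⟨z, hC x hx y hy z hz ((hf x (hCD hx) z hz).1 ht.1) ((hf z hz y (hCD hy)).1 ht.2), rfl⟩

theorem swap (h : IsRealInterval le C) : IsRealInterval (fun x y => le y x) C := by
  obtain ⟨f, hf, ho⟩ := h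
  refine ⟨fun x => -f x, fun x hx y hy => neg_le_neg_iff.trans (hf y hy x hx), ⟨?_⟩⟩
  rintro _ ⟨x, hx, rfl⟩ _ ⟨y, hy, rfl⟩ t ht
  obtain ⟨z, hz, hzt⟩ := ho.out ⟨y, hy, rfl⟩ ⟨x, hx, rfl⟩
    (show -t ∈ Set.Icc (f y) (f x) from ⟨by linarith [ht.2], by linarith [ht.1]⟩)
  exact ⟨z, hz, by simp [hzt]⟩

theorem congr {le' : X → X → Prop} (h : IsRealInterval le C)
    (hle : ∀ x ∈ C, ∀ y ∈ C, (le x y ↔ le' x y)) : IsRealInterval le' C := by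
  obtain ⟨f, hf, ho⟩ := h
  exact ⟨f, fun x hx y hy => (hf x hx y hy).trans (hle x hx y hy), ho⟩

theorem comap (g : Y → X) {C : Set Y} (h : IsRealInterval le (g '' C)) :
    IsRealInterval (fun x y => le (g x) (g y)) C := by
  obtain ⟨f, hf, ho⟩ := h
  refine ⟨f ∘ g, fun x hx y hy => hf _ ⟨x, hx, rfl⟩ _ ⟨y, hy, rfl⟩, ?_⟩
  rwa [Set.image_comp]

/-- Two intervals with a common endpoint glue to an interval. -/
theorem glue [PartialOrder X] {c : X} (hc : c ∈ C) (htot : ∀ x ∈ C, x ≤ c ∨ c ≤ x)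
    (h₁ : IsRealInterval (· ≤ ·) {x ∈ C | x ≤ c})
    (h₂ : IsRealInterval (· ≤ ·) {x ∈ C | c ≤ x}) :
    IsRealInterval (· ≤ ·) C := by
  classical
  obtain ⟨f, hf, hfo⟩ := h₁
  obtain ⟨g, hg, hgo⟩ := h₂
  let k : X → ℝ := fun x => if x ≤ c then f x - f c else g x - g c
  have hk₁ : ∀ x, x ≤ c → k x = f x - f c := fun x hx => if_pos hx
  have hk₂ : ∀ x, c ≤ x → k x = g x - g c := by
    intro x hx
    by_cases hxc : x ≤ c
    · obtain rfl := le_antisymm hx hxc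
      simp [k]
    · exact if_neg hxc
  have hk₁' : ∀ x ∈ C, x ≤ c → k x ≤ 0 := fun x hx hxc => by
    have := (hf x ⟨hx, hxc⟩ c ⟨hc, le_rfl⟩).2 hxc
    rw [hk₁ x hxc]; linarith
  have hk₂' : ∀ x ∈ C, c ≤ x → 0 ≤ k x := fun x hx hxc => by
    have := (hg c ⟨hc, le_rfl⟩ x ⟨hx, hxc⟩).2 hxc
    rw [hk₂ x hxc]; linarith
  have hk₃ : ∀ x ∈ C, c ≤ x → k x ≤ 0 → x ≤ c := fun x hx hxc h0 => by
    rw [hk₂ x hxc] at h0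
    exact (hg x ⟨hx, hxc⟩ c ⟨hc, le_rfl⟩).1 (by linarith)
  have hk₄ : ∀ x ∈ C, x ≤ c → 0 ≤ k x → c ≤ x := fun x hx hxc h0 => by
    rw [hk₁ x hxc] at h0
    exact (hf c ⟨hc, le_rfl⟩ x ⟨hx, hxc⟩).1 (by linarith)
  refine ⟨k, fun x hx y hy => ?_, ?_⟩
  · rcases htot x hx with hxc | hxc <;> rcases htot y hy with hyc | hyc
    · rw [hk₁ x hxc, hk₁ y hyc, ← hf x ⟨hx, hxc⟩ y ⟨hy, hyc⟩]
      exact sub_le_sub_iff_right _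
    · exact ⟨fun _ => hxc.trans hyc, fun _ => (hk₁' x hx hxc).trans (hk₂' y hy hyc)⟩
    · exact ⟨fun hle => (hk₃ x hx hxc (hle.trans (hk₁' y hy hyc))).trans
          (hk₄ y hy hyc ((hk₂' x hx hxc).trans hle)), fun hle => by
        rw [le_antisymm hle (hyc.trans hxc)]⟩
    · rw [hk₂ x hxc, hk₂ y hyc, ← hg x ⟨hx, hxc⟩ y ⟨hy, hyc⟩]
      exact sub_le_sub_iff_right _
  · have himage : k '' C = (fun t => t - f c) '' (f '' {x ∈ C | x ≤ c}) ∪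
        (fun t => t - g c) '' (g '' {x ∈ C | c ≤ x}) := by
      rw [Set.image_image, Set.image_image]
      ext t
      constructor
      · rintro ⟨x, hx, rfl⟩
        rcases htot x hx with hxc | hxc
        · exact Or.inl ⟨x, ⟨hx, hxc⟩, (hk₁ x hxc).symm⟩
        · exact Or.inr ⟨x, ⟨hx, hxc⟩, (hk₂ x hxc).symm⟩
      · rintro (⟨x, ⟨hx, hxc⟩, rfl⟩ | ⟨x, ⟨hx, hxc⟩, rfl⟩)
        · exact ⟨x, hx, hk₁ x hxc⟩
        · exact ⟨x, hx, hk₂ x hxc⟩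
    rw [himage]
    have h₁ : (0 : ℝ) ∈ (fun t => t - f c) '' (f '' {x ∈ C | x ≤ c}) :=
      ⟨f c, ⟨c, ⟨hc, le_rfl⟩, rfl⟩, sub_self _⟩
    have h₂ : (0 : ℝ) ∈ (fun t => t - g c) '' (g '' {x ∈ C | c ≤ x}) :=
      ⟨g c, ⟨c, ⟨hc, le_rfl⟩, rfl⟩, sub_self _⟩
    refine (IsPreconnected.union 0 h₁ h₂ ?_ ?_).ordConnected
    · exact hfo.isPreconnected.image _ (by fun_prop)
    · exact hgo.isPreconnected.image _ (by fun_prop)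

theorem exists_orderIso [PartialOrder X] (h : IsRealInterval (· ≤ ·) C) :
    ∃ s : Set ℝ, s.OrdConnected ∧ Nonempty (C ≃o s) := by
  obtain ⟨f, hf, ho⟩ := h
  have hinj : Set.InjOn f C := fun x hx y hy e =>
    le_antisymm ((hf x hx y hy).1 e.le) ((hf y hy x hx).1 e.ge)
  exact ⟨f '' C, ho, ⟨⟨Equiv.Set.imageOfInjOn f C hinj, fun {a b} => hf a a.2 b b.2⟩⟩⟩

theorem of_orderIso [PartialOrder X] {s : Set ℝ} (hs : s.OrdConnected) (e : C ≃o s) :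
    IsRealInterval (· ≤ ·) C := by
  classical
  have hval : ∀ x (hx : x ∈ C), (if hx : x ∈ C then (e ⟨x, hx⟩ : ℝ) else 0) = e ⟨x, hx⟩ :=
    fun x hx => dif_pos hx
  refine ⟨fun x => if hx : x ∈ C then (e ⟨x, hx⟩ : ℝ) else 0, fun x hx y hy => ?_, ?_⟩
  · simp only [hval x hx, hval y hy]
    exact e.le_iff_le
  · convert hs
    ext t
    constructor
    · rintro ⟨x, hx, rfl⟩
      simp only [hval x hx]
      exact (e ⟨x, hx⟩).2
    · intro ht
      refine ⟨e.symm ⟨t, ht⟩, (e.symm ⟨t, ht⟩).2, (hval _ (e.symm ⟨t, ht⟩).2).trans ?_⟩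
      rw [Subtype.coe_eta, OrderIso.apply_symm_apply]

end IsRealInterval

/-- In the rooted order, infima exist as soon as the lower segments are real intervals. -/
theorem IsTreeBtw.exists_isGLB {X : Type*} {B : X → X → X → Prop} (h : IsTreeBtw B) (r : X)
    (hI : ∀ a, IsRealInterval (B r) {x | B r x a}) (A : Set X) (hA : A.Nonempty) :
    ∃ z, @IsGLB X (h.rootedOrder r).toLE A z := by
  let := h.rootedOrder r
  obtain ⟨a₀, ha₀⟩ := hA
  obtain ⟨f, hf, ho⟩ := hI a₀
  choose m h₁ h₂ h₃ using fun a => h.median r a₀ a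
  have hr : B r r a₀ := h.left r a₀
  have hlow : ∀ a, f r ≤ f (m a) := fun a => (hf r hr (m a) (h₁ a)).2 (h.left r _)
  have hbdd : BddBelow ((fun a => f (m a)) '' A) := by
    refine ⟨f r, ?_⟩
    rintro _ ⟨a, -, rfl⟩
    exact hlow a
  have hne : ((fun a => f (m a)) '' A).Nonempty := ⟨_, a₀, ha₀, rfl⟩
  obtain ⟨z, hz, hzt⟩ := ho.out ⟨r, hr, rfl⟩ ⟨m a₀, h₁ a₀, rfl⟩
    (show sInf ((fun a => f (m a)) '' A) ∈ Set.Icc (f r) (f (m a₀)) from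
      ⟨le_csInf hne (by rintro _ ⟨a, -, rfl⟩; exact hlow a), csInf_le hbdd ⟨a₀, ha₀, rfl⟩⟩)
  refine ⟨z, fun a ha => ?_, fun y hy => ?_⟩
  · have : B r z (m a) := (hf z hz (m a) (h₁ a)).1 (hzt ▸ csInf_le hbdd ⟨a, ha, rfl⟩)
    exact (h.trans (h₃ a) this).1
  · have hy₀ : B r y a₀ := hy ha₀
    refine (hf y hy₀ z hz).1 (hzt ▸ le_csInf hne ?_)
    rintro _ ⟨a, ha, rfl⟩
    refine (hf y hy₀ (m a) (h₁ a)).2 ((h.isGLB_median (h₁ a) (h₃ a) (h₂ a)).2 ?_)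
    rintro x (rfl | rfl)
    exacts [hy₀, hy ha]

/-- `x` lies between `a` and `b` in a meet-semilattice. -/
def InfBtw {T : Type*} [SemilatticeInf T] (a x b : T) : Prop :=
  a ⊓ b ≤ x ∧ (x ≤ a ∨ x ≤ b)

theorem treeSegment_eq_infBtw {T : Type*} [SemilatticeInf T] (a b : T) :
    treeSegment a b = {x | InfBtw a x b} := by
  ext x
  constructor
  · rintro ⟨w, hw, h⟩
    obtain rfl := hw.unique isGLB_pair
    exact h
  · exact fun h => ⟨a ⊓ b, isGLB_pair, h⟩

theorem isTreeBtw_infBtw {T : Type*} [SemilatticeInf T]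
    (hT : ∀ a x y : T, x ≤ a → y ≤ a → x ≤ y ∨ y ≤ x) : IsTreeBtw (InfBtw (T := T)) where
  left a b := ⟨inf_le_left, Or.inl le_rfl⟩
  symm := fun h => ⟨inf_comm _ _ |>.trans_le h.1, h.2.symm⟩
  eq_of_self := fun h => le_antisymm (h.2.elim id id) (inf_idem _ |>.ge.trans h.1)
  trans := by
    rintro a x b y ⟨h₁, h₂⟩ ⟨h₃, h₄⟩
    refine ⟨⟨(le_inf inf_le_left h₁).trans h₃, ?_⟩, ?_, ?_⟩
    · exact h₄.elim Or.inl fun h => h₂.imp h.trans h.trans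
    · rcases h₄ with h | h
      · exact (inf_le_inf_right b h).trans h₁
      · exact inf_le_left.trans h
    · exact h₂.imp (fun h => (le_inf h le_rfl).trans h₃) id
  total := by
    rintro a x b y ⟨h₁, h₂⟩ ⟨h₃, h₄⟩
    rcases h₂ with h₂ | h₂ <;> rcases h₄ with h₄ | h₄
    · rcases hT a x y h₂ h₄ with h | h
      · exact Or.inr ⟨inf_le_right.trans h, Or.inl h₄⟩
      · exact Or.inl ⟨inf_le_right.trans h, Or.inl h₂⟩
    · exact Or.inl ⟨(inf_le_inf_left a h₄).trans h₁, Or.inl h₂⟩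
    · exact Or.inr ⟨(inf_le_inf_left a h₂).trans h₃, Or.inl h₄⟩
    · rcases hT b x y h₂ h₄ with h | h
      · exact Or.inl ⟨(inf_le_inf_left a h₄).trans h₁, Or.inr h⟩
      · exact Or.inr ⟨(inf_le_inf_left a h₂).trans h₃, Or.inr h⟩
  median := by
    intro a b c
    have h₁ := hT a (a ⊓ b) (a ⊓ c) inf_le_left inf_le_left
    have h₂ := hT b (a ⊓ b) (b ⊓ c) inf_le_right inf_le_left
    have h₃ := hT c (a ⊓ c) (b ⊓ c) inf_le_right inf_le_right
    have hab : a ⊓ b ≤ a ∧ a ⊓ b ≤ b := ⟨inf_le_left, inf_le_right⟩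
    have hbc : b ⊓ c ≤ b ∧ b ⊓ c ≤ c := ⟨inf_le_left, inf_le_right⟩
    have hac : a ⊓ c ≤ a ∧ a ⊓ c ≤ c := ⟨inf_le_left, inf_le_right⟩
    have key : (a ⊓ c ≤ a ⊓ b ∧ b ⊓ c ≤ a ⊓ b) ∨ (a ⊓ b ≤ a ⊓ c ∧ b ⊓ c ≤ a ⊓ c) ∨
        (a ⊓ b ≤ b ⊓ c ∧ a ⊓ c ≤ b ⊓ c) := by
      rcases h₁ with h₁ | h₁
      · rcases h₃ with h₃ | h₃
        · exact Or.inr (Or.inr ⟨h₁.trans h₃, h₃⟩)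
        · exact Or.inr (Or.inl ⟨h₁, h₃⟩)
      · rcases h₂ with h₂ | h₂
        · exact Or.inr (Or.inr ⟨h₂, h₁.trans h₂⟩)
        · exact Or.inl ⟨h₁, h₂⟩
    rcases key with h | h | h
    · exact ⟨a ⊓ b, ⟨le_rfl, Or.inl hab.1⟩, ⟨h.2, Or.inl hab.2⟩, h.1, Or.inl hab.1⟩
    · exact ⟨a ⊓ c, ⟨h.1, Or.inl hac.1⟩, ⟨h.2, Or.inr hac.2⟩, le_rfl, Or.inl hac.1⟩
    · exact ⟨b ⊓ c, ⟨h.1, Or.inr hbc.1⟩, ⟨le_rfl, Or.inl hbc.1⟩, h.2, Or.inr hbc.2⟩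

namespace IsTreePO

/-- A tree is a meet-semilattice. -/
noncomputable abbrev semilatticeInf {T : Type*} [PartialOrder T] (hT : IsTreePO T) :
    SemilatticeInf T where
  inf a b := (hT.exists_inf {a, b} ⟨a, Or.inl rfl⟩).choose
  inf_le_left a b := (hT.exists_inf {a, b} ⟨a, Or.inl rfl⟩).choose_spec.1 (Or.inl rfl)
  inf_le_right a b := (hT.exists_inf {a, b} ⟨a, Or.inl rfl⟩).choose_spec.1 (Or.inr rfl)
  le_inf a b c hb hc := (hT.exists_inf {b, c} ⟨b, Or.inl rfl⟩).choose_spec.2 (by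
    rintro x (rfl | rfl)
    exacts [hb, hc])

variable {T : Type*}

theorem le_total_of_le_s15 [PartialOrder T] (hT : IsTreePO T) (a x y : T) (hx : x ≤ a)
    (hy : y ≤ a) : x ≤ y ∨ y ≤ x := by
  obtain ⟨s, -, ⟨e⟩⟩ := hT.below_iso a
  exact (le_total (e ⟨x, hx⟩) (e ⟨y, hy⟩)).imp e.le_iff_le.1 e.le_iff_le.1

theorem isRealInterval_Iic [PartialOrder T] (hT : IsTreePO T) (a : T) :
    IsRealInterval (· ≤ ·) (Set.Iic a) :=
  let ⟨_, hs, ⟨e⟩⟩ := hT.below_iso a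
  .of_orderIso hs e

theorem isRealInterval_of_isChain [PartialOrder T] (hT : IsTreePO T) {C : Set T}
    (hC : IsChain (· ≤ ·) C) (ho : C.OrdConnected) : IsRealInterval (· ≤ ·) C :=
  let ⟨_, hs, ⟨e⟩⟩ := hT.chain_iso C hC ho
  .of_orderIso hs e

theorem infBtw_iff_of_le [SemilatticeInf T] {r x y : T} (hx : x ≤ r) (hy : y ≤ r) :
    InfBtw r x y ↔ y ≤ x := by
  simp [InfBtw, hx, hy]

/-- Convex subsets of `Iic r` are real intervals for the order rooted at `r`. -/
theorem isRealInterval_of_subset_Iic [SemilatticeInf T] (hT : IsTreePO T) {r : T} {C : Set T}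
    (hCr : ∀ x ∈ C, x ≤ r) (ho : C.OrdConnected) : IsRealInterval (InfBtw r) C :=
  ((hT.isRealInterval_Iic r).mono hCr fun _ hx _ hy _ _ h₁ h₂ => ho.out hx hy ⟨h₁, h₂⟩).swap.congr
    fun x hx y hy => (infBtw_iff_of_le (hCr x hx) (hCr y hy)).symm

theorem isRealInterval_segment [SemilatticeInf T] (hT : IsTreePO T) (r a : T) :
    IsRealInterval (InfBtw r) {x | InfBtw r x a} := by
  have h := isTreeBtw_infBtw hT.le_total_of_le_s15
  have hw : InfBtw r (r ⊓ a) a := ⟨le_rfl, Or.inl inf_le_left⟩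
  refine @IsRealInterval.glue T _ (h.rootedOrder r) (r ⊓ a) hw
    (fun x hx => h.total hx hw) ?_ ?_
  · have : {x | InfBtw r x a ∧ InfBtw r x (r ⊓ a)} = Set.Icc (r ⊓ a) r := by
      ext x
      constructor
      · rintro ⟨h₁, h₂⟩
        exact ⟨h₁.1, h₂.2.elim id fun h => h.trans inf_le_left⟩
      · rintro ⟨h₁, h₂⟩
        exact ⟨⟨h₁, Or.inl h₂⟩, inf_le_right.trans h₁, Or.inl h₂⟩
    change IsRealInterval (InfBtw r) {x | InfBtw r x a ∧ InfBtw r x (r ⊓ a)}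
    rw [this]
    exact hT.isRealInterval_of_subset_Iic (fun x hx => hx.2) Set.ordConnected_Icc
  · have : {x | InfBtw r x a ∧ InfBtw r (r ⊓ a) x} = Set.Icc (r ⊓ a) a := by
      ext x
      constructor
      · rintro ⟨h₁, h₂⟩
        refine ⟨h₁.1, h₁.2.elim (fun hxr => ?_) id⟩
        exact (le_inf hxr le_rfl).trans (h₂.1.trans inf_le_right)
      · rintro ⟨h₁, h₂⟩
        exact ⟨⟨h₁, Or.inr h₂⟩, inf_le_inf_left r h₂, Or.inl inf_le_left⟩
    change IsRealInterval (InfBtw r) {x | InfBtw r x a ∧ InfBtw r (r ⊓ a) x}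
    rw [this]
    refine ((hT.isRealInterval_Iic a).mono (fun x hx => hx.2)
      fun x hx y hy z _ h₁ h₂ => Set.mem_Icc.2 ⟨hx.1.trans h₁, h₂.trans hy.2⟩).congr ?_
    rintro x ⟨hx₁, hx₂⟩ y ⟨hy₁, hy₂⟩
    refine ⟨fun hxy => ⟨(inf_le_inf_left r hy₂).trans hx₁, Or.inr hxy⟩, fun hxy => ?_⟩
    exact hxy.2.elim (fun hxr => (le_inf hxr hx₂).trans hy₁) id

/-- Convex chains for the order rooted at `r`, restricted to a set closed under segments, are
real intervals. -/
theorem isRealInterval_of_isChain_rooted [SemilatticeInf T] (hT : IsTreePO T) (r : T) {C : Set T}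
    (hC : ∀ x ∈ C, ∀ y ∈ C, InfBtw r x y ∨ InfBtw r y x)
    (ho : ∀ x ∈ C, ∀ y ∈ C, ∀ z, InfBtw x z y → InfBtw r x z → InfBtw r z y → z ∈ C) :
    IsRealInterval (InfBtw r) C := by
  have h := isTreeBtw_infBtw hT.le_total_of_le_s15
  by_cases hCr : ∀ x ∈ C, x ≤ r
  · refine hT.isRealInterval_of_subset_Iic hCr ⟨fun x hx y hy z hz => ?_⟩
    have hzr : z ≤ r := hz.2.trans (hCr y hy)
    exact ho y hy x hx z ⟨inf_le_right.trans hz.1, Or.inl hz.2⟩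
      ((infBtw_iff_of_le (hCr y hy) hzr).2 hz.2) ((infBtw_iff_of_le hzr (hCr x hx)).2 hz.1)
  · push Not at hCr
    obtain ⟨c, hc, hcr⟩ := hCr
    refine @IsRealInterval.glue T _ (h.rootedOrder r) c hc (fun x hx => hC x hx c hc) ?_ ?_
    · refine (hT.isRealInterval_segment r c).mono (fun x hx => hx.2) ?_
      rintro x ⟨hx, hxc⟩ y ⟨hy, hyc⟩ z hz h₁ h₂
      exact ⟨ho x hx y hy z (h.trans h₂ h₁).2 h₁ h₂, hz⟩
    · have hge : ∀ x, InfBtw r c x ↔ c ≤ x ∧ r ⊓ x ≤ c := fun x =>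
        ⟨fun hx => ⟨hx.2.resolve_left hcr, hx.1⟩, fun hx => ⟨hx.2, Or.inr hx.1⟩⟩
      have hle : ∀ x y, InfBtw r c x → InfBtw r c y → (x ≤ y ↔ InfBtw r x y) := by
        intro x y hx hy
        rw [hge] at hx hy
        exact ⟨fun hxy => ⟨hy.2.trans hx.1, Or.inr hxy⟩,
          fun hxy => hxy.2.resolve_left fun hxr => hcr (hx.1.trans hxr)⟩
      change IsRealInterval (InfBtw r) {x | x ∈ C ∧ InfBtw r c x}
      refine (hT.isRealInterval_of_isChain ?_ ?_).congr fun x hx y hy => hle x y hx.2 hy.2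
      · rintro x ⟨hx, hx'⟩ y ⟨hy, hy'⟩ -
        exact (hC x hx y hy).imp (hle x y hx' hy').2 (hle y x hy' hx').2
      · refine ⟨?_⟩
        rintro x ⟨hx, hx'⟩ y ⟨hy, hy'⟩ z ⟨hxz, hzy⟩
        have hz' : InfBtw r c z := (hge z).2
          ⟨((hge x).1 hx').1.trans hxz, (inf_le_inf_left r hzy).trans hy'.1⟩
        exact ⟨ho x hx y hy z ⟨inf_le_left.trans hxz, Or.inr hzy⟩ ((hle x z hx' hz').1 hxz)
          ((hle z y hz' hy').1 hzy), hz'⟩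

/-- A nonempty set closed under segments is a tree for the order rooted at any of its points. -/
theorem rootedOrder_restrict [SemilatticeInf T] (hT : IsTreePO T) {S : Set T}
    (hS : ∀ a ∈ S, ∀ b ∈ S, ∀ x, InfBtw a x b → x ∈ S) (r : S)
    (h : IsTreeBtw fun a x b : S => InfBtw (a : T) x b) :
    @IsTreePO S (h.rootedOrder r) := by
  have hchain : ∀ C : Set S,
      (∀ x ∈ C, ∀ y ∈ C, InfBtw (r : T) x y ∨ InfBtw (r : T) y x) →
      (∀ x ∈ C, ∀ y ∈ C, ∀ z : S, InfBtw (r : T) x z → InfBtw (r : T) z y → z ∈ C) →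
      IsRealInterval (fun x y : S => InfBtw (r : T) x y) C := by
    intro C hC ho
    refine IsRealInterval.comap Subtype.val (hT.isRealInterval_of_isChain_rooted r ?_ ?_)
    · rintro _ ⟨x, hx, rfl⟩ _ ⟨y, hy, rfl⟩
      exact hC x hx y hy
    · rintro _ ⟨x, hx, rfl⟩ _ ⟨y, hy, rfl⟩ z hz h₁ h₂
      have hzS : z ∈ S := hS x x.2 y y.2 z hz
      exact ⟨⟨z, hzS⟩, ho x hx y hy ⟨z, hzS⟩ h₁ h₂, rfl⟩
  have hIic : ∀ a : S, IsRealInterval (fun x y : S => InfBtw (r : T) x y)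
      {x : S | InfBtw (r : T) x a} :=
    fun a => hchain _ (fun x hx y hy => h.total hx hy)
      fun x _ y hy z _ h₂ => (h.trans hy h₂).1
  exact @IsTreePO.mk S (h.rootedOrder r) ⟨r, fun a => h.left r a⟩
    (fun a => @IsRealInterval.exists_orderIso S _ (h.rootedOrder r) (hIic a))
    (fun C hC ho => @IsRealInterval.exists_orderIso S C (h.rootedOrder r)
      (hchain C (fun x hx y hy => @IsChain.total S _ C x y ⟨h.right r⟩ hC hx hy)
        fun x hx y hy z h₁ h₂ =>
          @Set.OrdConnected.out S (h.rootedOrder r).toPreorder C ho x hx y hy z ⟨h₁, h₂⟩))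
    (h.exists_isGLB r hIic)

end IsTreePO

/-- Any arcwise connected subspace of a tree (with the weak tree
topology) is itself a tree: there is a partial order on the subspace making it a tree
whose weak tree topology coincides with the subspace topology. -/
theorem statement_15 {T : Type*} [PartialOrder T] (hT : IsTreePO T) (S : Set T)
    (hS : S.Nonempty)
    (harc : ∀ a ∈ S, ∀ b ∈ S, a ≠ b → ∃ γ : unitInterval → T,
      @Continuous _ _ _ (weakTreeTopology T) γ ∧ Function.Injective γ ∧
        Set.range γ ⊆ S ∧ γ 0 = a ∧ γ 1 = b) :
    @IsTopologicalTree S (TopologicalSpace.induced Subtype.val (weakTreeTopology T)) := by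
  let := hT.semilatticeInf
  have h := isTreeBtw_infBtw hT.le_total_of_le_s15
  have htop : weakTreeTopology T = btwTopology InfBtw :=
    h.weakTreeTopology_eq treeSegment_eq_infBtw
  have hconv : ∀ a ∈ S, ∀ b ∈ S, ∀ x, InfBtw a x b → x ∈ S := by
    intro a ha b hb x hx
    rcases eq_or_ne a b with rfl | hab
    · rwa [h.eq_of_self hx]
    obtain ⟨γ, hγ, -, hγS, rfl, rfl⟩ := harc a ha b hb hab
    rw [htop] at hγ
    exact hγS (h.mem_of_isPreconnected (@isPreconnected_range _ _ _ (_) _ _ hγ) ⟨0, rfl⟩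
      ⟨1, rfl⟩ hx)
  obtain ⟨r, hr⟩ := hS
  have hS' := h.restrict hconv
  refine ⟨hS'.rootedOrder ⟨r, hr⟩, hT.rootedOrder_restrict hconv ⟨r, hr⟩ hS', ?_⟩
  rw [htop, ← h.btwTopology_restrict hconv]
  exact @IsTreeBtw.weakTreeTopology_eq _ _ hS' (hS'.rootedOrder ⟨r, hr⟩)
    (hS'.treeSegment_rootedOrder ⟨r, hr⟩)
end
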